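/- Let q = 2^f ≥ 4 and let a ∈ 𝔽_q be such that the subfield of 𝔽_q generated by a is all of 𝔽_q and the polynomial X² + X + (a+1)⁴ is irreducible over 𝔽_q. Let x = x(a) and y be the 8×8 matrices over 𝔽_q with rows x: [0,a⁻¹,0,0,0,0,0,0], [a,0,0,0,0,0,0,0], [0,0,a²(a+1)⁻²,(a+1)⁻²,0,0,0,0], [0,0,(a+1)⁻²,a²(a+1)⁻²,0,0,0,0], [(a+1)²,a⁻¹,0,0,0,a,0,0], [a⁻¹,(a+1)²a⁻²,0,0,a⁻¹,0,0,0], [0,0,0,0,0,0,a²(a+1)⁻²,(a+1)⁻²], [0,0,0,0,0,0,(a+1)⁻²,a²(a+1)⁻²]; y: [0,0,0,0,1,0,0,0], [0,0,0,1,0,0,0,0], [0,1,0,0,0,0,0,0], [0,0,1,0,0,0,0,0], [1,0,0,0,1,0,0,0], [0,0,0,0,0,0,0,1], [0,0,0,0,0,1,0,0], [0,0,0,0,0,0,1,0]. Let Q be the quadratic form on 𝔽_q⁸ given by Q(v) = v₁² + v₅² + a²(v₂² + v₃² + v₄² + v₆² + v₇² + v₈²) + v₁v₅ + v₂v₆ +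 v₃v₇ + v₄v₈, and let O(Q) be the subgroup of GL₈(𝔽_q) of elements preserving Q. Then x has order 2, y has order 3, and the subgroup generated by x and y equals the derived subgroup of O(Q), i.e., equals Ω₈⁻(q). In particular Ω₈⁻(q) is (2,3)-generated for all even q. -/

import Mathlib

open Matrix

/-- A group is `(2,3)`-generated if it is generated by an element of order 2
together with an element of order 3. -/
def IsTwoThreeGenerated (G : Type*) [Group G] : Prop :=
  ∃ x y : G, orderOf x = 2 ∧ orderOf y = 3 ∧ Subgroup.closure {x, y} = ⊤

/-- The plus-type quadratic form `Q⁺(v) = v₁v₅ + v₂v₆ + v₃v₇ + v₄v₈` on `F⁸`. -/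
def QPlus (F : Type*) [Field F] (v : Fin 8 → F) : F :=
  v 0 * v 4 + v 1 * v 5 + v 2 * v 6 + v 3 * v 7

/-- The group of linear automorphisms of `F⁸` preserving the form `Q`,
as a subgroup of `GL₈(F)`. -/
def orthogonalGroupOf (F : Type*) [Field F] (Q : (Fin 8 → F) → F) :
    Subgroup (GL (Fin 8) F) where
  carrier := {g | ∀ v, Q ((g : Matrix (Fin 8) (Fin 8) F).mulVec v) = Q v}
  one_mem' := by
    intro v
    simp
  mul_mem' := by
    intro a b ha hb v
    have h : ((a * b : GL (Fin 8) F) : Matrix (Fin 8) (Fin 8) F).mulVec v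
        = (a : Matrix (Fin 8) (Fin 8) F).mulVec
            ((b : Matrix (Fin 8) (Fin 8) F).mulVec v) := by
      simp [Matrix.mulVec_mulVec]
    rw [h, ha, hb]
  inv_mem' := by
    intro a ha v
    have h1 : (a : Matrix (Fin 8) (Fin 8) F).mulVec
        (((a⁻¹ : GL (Fin 8) F) : Matrix (Fin 8) (Fin 8) F).mulVec v) = v := by
      rw [Matrix.mulVec_mulVec, ← Units.val_mul, mul_inv_cancel]
      simp
    calc Q (((a⁻¹ : GL (Fin 8) F) : Matrix (Fin 8) (Fin 8) F).mulVec v)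
        = Q ((a : Matrix (Fin 8) (Fin 8) F).mulVec
            (((a⁻¹ : GL (Fin 8) F) : Matrix (Fin 8) (Fin 8) F).mulVec v)) := (ha _).symm
      _ = Q v := by rw [h1]

/-- The minus-type quadratic form
`Q(v) = v₁² + v₅² + a²(v₂²+v₃²+v₄²+v₆²+v₇²+v₈²) + v₁v₅ + v₂v₆ + v₃v₇ + v₄v₈`. -/
def QMinusEven {F : Type*} [Field F] (a : F) (v : Fin 8 → F) : F :=
  v 0 ^ 2 + v 4 ^ 2 +
    a ^ 2 * (v 1 ^ 2 + v 2 ^ 2 + v 3 ^ 2 + v 5 ^ 2 + v 6 ^ 2 + v 7 ^ 2) +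
    v 0 * v 4 + v 1 * v 5 + v 2 * v 6 + v 3 * v 7

/-- The generator `x = x(a)` of order 2 for `Ω₈⁻(q)` in characteristic 2. -/
def xMinusEven (K : Type*) [Field K] (a : K) : Matrix (Fin 8) (Fin 8) K :=
  !![0, a⁻¹, 0, 0, 0, 0, 0, 0;
     a, 0, 0, 0, 0, 0, 0, 0;
     0, 0, a^2 * ((a+1)^2)⁻¹, ((a+1)^2)⁻¹, 0, 0, 0, 0;
     0, 0, ((a+1)^2)⁻¹, a^2 * ((a+1)^2)⁻¹, 0, 0, 0, 0;
     (a+1)^2, a⁻¹, 0, 0, 0, a, 0, 0;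
     a⁻¹, (a+1)^2 * (a^2)⁻¹, 0, 0, a⁻¹, 0, 0, 0;
     0, 0, 0, 0, 0, 0, a^2 * ((a+1)^2)⁻¹, ((a+1)^2)⁻¹;
     0, 0, 0, 0, 0, 0, ((a+1)^2)⁻¹, a^2 * ((a+1)^2)⁻¹]

/-- The generator `y` of order 3 for `Ω₈⁻(q)` in characteristic 2. -/
def yMinusEven (K : Type*) [Field K] : Matrix (Fin 8) (Fin 8) K :=
  !![0, 0, 0, 0, 1, 0, 0, 0;
     0, 0, 0, 1, 0, 0, 0, 0;
     0, 1, 0, 0, 0, 0, 0, 0;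
     0, 0, 1, 0, 0, 0, 0, 0;
     1, 0, 0, 0, 1, 0, 0, 0;
     0, 0, 0, 0, 0, 0, 0, 1;
     0, 0, 0, 0, 0, 1, 0, 0;
     0, 0, 0, 0, 0, 0, 1, 0]

section Form

variable {F : Type*} [Field F]

/-- The polar form of `QMinusEven` in characteristic two. -/
def polarForm (u v : Fin 8 → F) : F :=
  u 0 * v 4 + u 4 * v 0 + u 1 * v 5 + u 5 * v 1 + u 2 * v 6 + u 6 * v 2 + u 3 * v 7 + u 7 * v 3

theorem polarForm_add_left (u u' v : Fin 8 → F) :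
    polarForm (u + u') v = polarForm u v + polarForm u' v := by
  simp only [polarForm, Pi.add_apply]; ring

theorem polarForm_add_right (u v v' : Fin 8 → F) :
    polarForm u (v + v') = polarForm u v + polarForm u v' := by
  simp only [polarForm, Pi.add_apply]; ring

theorem polarForm_smul_left (c : F) (u v : Fin 8 → F) :
    polarForm (c • u) v = c * polarForm u v := by
  simp only [polarForm, Pi.smul_apply, smul_eq_mul]; ring

theorem polarForm_smul_right (c : F) (u v : Fin 8 → F) :
    polarForm u (c • v) = c * polarForm u v := by
  simp only [polarForm, Pi.smul_apply, smul_eq_mul]; ring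

theorem polarForm_comm (u v : Fin 8 → F) : polarForm u v = polarForm v u := by
  simp only [polarForm]; ring

theorem polarForm_zero_right (u : Fin 8 → F) : polarForm u 0 = 0 := by
  simp [polarForm]

/-- The polar form as a linear functional of its second argument. -/
def polarLin (u : Fin 8 → F) : (Fin 8 → F) →ₗ[F] F where
  toFun := polarForm u
  map_add' := polarForm_add_right u
  map_smul' c v := polarForm_smul_right c u v

@[simp] theorem polarLin_apply (u v : Fin 8 → F) : polarLin u v = polarForm u v := rfl

/-- Every linear functional is represented by the polar form. -/
theorem exists_polarForm_eq (φ : (Fin 8 → F) →ₗ[F] F) :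
    ∃ w : Fin 8 → F, ∀ z, polarForm z w = φ z := by
  let e : Fin 8 → (Fin 8 → F) := fun i => Pi.single i 1
  refine ⟨![φ (e 4), φ (e 5), φ (e 6), φ (e 7), φ (e 0), φ (e 1), φ (e 2), φ (e 3)], fun z => ?_⟩
  have hz : z = ∑ i, z i • e i := by
    ext j; simp [e, Finset.sum_apply, Pi.single_apply]
  conv_rhs => rw [hz]
  simp only [Fin.sum_univ_eight, polarForm]
  simp
  ring

theorem eq_zero_of_polarForm_eq_zero {u : Fin 8 → F} (h : ∀ v, polarForm u v = 0) : u = 0 := by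
  ext i
  obtain ⟨w, hw⟩ := exists_polarForm_eq (LinearMap.proj i : (Fin 8 → F) →ₗ[F] F)
  simpa [h w] using (hw u).symm

theorem exists_polarForm_ne_zero {u : Fin 8 → F} (h : u ≠ 0) : ∃ v, polarForm u v ≠ 0 := by
  by_contra! hc
  exact h (eq_zero_of_polarForm_eq_zero hc)

/-- A vector outside a subspace is separated from it by the orthogonal complement. -/
theorem exists_orthogonal_of_notMem {S : Submodule F (Fin 8 → F)} {v : Fin 8 → F} (hv : v ∉ S) :
    ∃ w, (∀ z ∈ S, polarForm z w = 0) ∧ polarForm v w = 1 := by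
  obtain ⟨φ, hφv, hφS⟩ := Submodule.exists_le_ker_of_notMem hv
  obtain ⟨w, hw⟩ := exists_polarForm_eq ((φ v)⁻¹ • φ)
  refine ⟨w, fun z hz => ?_, ?_⟩
  · rw [hw]; simp [LinearMap.mem_ker.1 (hφS hz)]
  · rw [hw]; simp [hφv]

theorem QMinusEven_smul (a c : F) (v : Fin 8 → F) :
    QMinusEven a (c • v) = c ^ 2 * QMinusEven a v := by
  simp only [QMinusEven, Pi.smul_apply, smul_eq_mul]; ring

theorem mem_orthogonalGroupOf {a : F} {g : GL (Fin 8) F} :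
    g ∈ orthogonalGroupOf F (QMinusEven a) ↔
      ∀ v, QMinusEven a (g.1 *ᵥ v) = QMinusEven a v := Iff.rfl

theorem gl_ext {g h : GL (Fin 8) F} (H : ∀ v, g.1 *ᵥ v = h.1 *ᵥ v) : g = h :=
  Units.ext (Matrix.mulVec_injective (funext H))

theorem gl_mul_mulVec (g h : GL (Fin 8) F) (v : Fin 8 → F) :
    (g * h).1 *ᵥ v = g.1 *ᵥ (h.1 *ᵥ v) := by
  rw [Units.val_mul, Matrix.mulVec_mulVec]

theorem gl_inv_mulVec_mulVec (g : GL (Fin 8) F) (v : Fin 8 → F) :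
    (g⁻¹).1 *ᵥ (g.1 *ᵥ v) = v := by
  rw [← gl_mul_mulVec, inv_mul_cancel, Units.val_one, one_mulVec]

theorem gl_mulVec_inv_mulVec (g : GL (Fin 8) F) (v : Fin 8 → F) :
    g.1 *ᵥ ((g⁻¹).1 *ᵥ v) = v := by
  rw [← gl_mul_mulVec, mul_inv_cancel, Units.val_one, one_mulVec]

variable [CharP F 2]

theorem two_eq_zero_of_charTwo : (2 : F) = 0 := by exact_mod_cast CharP.cast_eq_zero F 2

theorem polarForm_self (u : Fin 8 → F) : polarForm u u = 0 := by
  have h2 : (2 : F) = 0 := two_eq_zero_of_charTwo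
  simp only [polarForm]
  linear_combination (u 0 * u 4 + u 1 * u 5 + u 2 * u 6 + u 3 * u 7) * h2

theorem QMinusEven_add (a : F) (u v : Fin 8 → F) :
    QMinusEven a (u + v) = QMinusEven a u + QMinusEven a v + polarForm u v := by
  have h2 : (2 : F) = 0 := two_eq_zero_of_charTwo
  simp only [QMinusEven, polarForm, Pi.add_apply]
  linear_combination (u 0 * v 0 + u 4 * v 4 + a ^ 2 * (u 1 * v 1 + u 2 * v 2 + u 3 * v 3 +
    u 5 * v 5 + u 6 * v 6 + u 7 * v 7)) * h2

theorem add_self_charTwo (u : Fin 8 → F) : u + u = 0 := by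
  ext i; exact CharTwo.add_self_eq_zero (u i)

theorem polarForm_mulVec {a : F} {g : GL (Fin 8) F}
    (hg : g ∈ orthogonalGroupOf F (QMinusEven a)) (u v : Fin 8 → F) :
    polarForm (g.1 *ᵥ u) (g.1 *ᵥ v) = polarForm u v := by
  have h := QMinusEven_add a (g.1 *ᵥ u) (g.1 *ᵥ v)
  rw [← mulVec_add, mem_orthogonalGroupOf.1 hg, mem_orthogonalGroupOf.1 hg,
    mem_orthogonalGroupOf.1 hg, QMinusEven_add] at h
  exact (add_left_cancel h).symm

/-- A linear map preserving the form is given by an element of the orthogonal group. -/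
theorem exists_orthogonal_of_linearMap {a : F} (f : (Fin 8 → F) →ₗ[F] (Fin 8 → F))
    (hf : ∀ v, QMinusEven a (f v) = QMinusEven a v) :
    ∃ g ∈ orthogonalGroupOf F (QMinusEven a), ∀ v, g.1 *ᵥ v = f v := by
  have hB : ∀ u v, polarForm (f u) (f v) = polarForm u v := fun u v => by
    have h := QMinusEven_add a (f u) (f v)
    rw [← map_add, hf, hf, hf, QMinusEven_add] at h
    exact (add_left_cancel h).symm
  have hinj : Function.Injective f := by
    rw [injective_iff_map_eq_zero]
    intro z hz
    refine eq_zero_of_polarForm_eq_zero fun v => ?_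
    rw [← hB, hz, polarForm_comm, polarForm_zero_right]
  let e := LinearEquiv.ofInjectiveEndo f hinj
  have he : ∀ v, e v = f v := fun v => rfl
  let g : GL (Fin 8) F :=
    { val := LinearMap.toMatrix' e.toLinearMap
      inv := LinearMap.toMatrix' e.symm.toLinearMap
      val_inv := by rw [← LinearMap.toMatrix'_comp]; simp
      inv_val := by rw [← LinearMap.toMatrix'_comp]; simp }
  have hg : ∀ v, g.1 *ᵥ v = f v := fun v => by
    change LinearMap.toMatrix' e.toLinearMap *ᵥ v = f v
    rw [LinearMap.toMatrix'_mulVec]; rfl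
  exact ⟨g, mem_orthogonalGroupOf.2 fun v => by rw [hg, hf], hg⟩

end Form

section Siegel

variable {F : Type*} [Field F]

/-- The Siegel transformation attached to a singular vector `p` and a vector `w` orthogonal
to it. -/
def siegel (a : F) (p w : Fin 8 → F) : (Fin 8 → F) →ₗ[F] (Fin 8 → F) where
  toFun z := z + polarForm z p • w + (polarForm z w + QMinusEven a w * polarForm z p) • p
  map_add' u v := by
    ext i
    simp only [polarForm_add_left, Pi.add_apply, Pi.smul_apply, smul_eq_mul]
    ring
  map_smul' c u := by
    ext i
    simp only [polarForm_smul_left, Pi.add_apply, Pi.smul_apply, smul_eq_mul, RingHom.id_apply]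
    ring

theorem siegel_apply (a : F) (p w z : Fin 8 → F) :
    siegel a p w z =
      z + polarForm z p • w + (polarForm z w + QMinusEven a w * polarForm z p) • p := rfl

/-- `H` contains the Siegel transformation attached to `p` and `w`. -/
def HasSiegel (a : F) (H : Subgroup (GL (Fin 8) F)) (p w : Fin 8 → F) : Prop :=
  QMinusEven a p = 0 ∧ polarForm p w = 0 ∧ ∃ g ∈ H, ∀ z, g.1 *ᵥ z = siegel a p w z

variable {a : F}

theorem siegel_zero (p z : Fin 8 → F) : siegel a p 0 z = z := by
  ext i
  simp [siegel_apply, polarForm_zero_right, QMinusEven]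

theorem siegel_smul_left (c : F) (p w z : Fin 8 → F) :
    siegel a (c • p) w z = siegel a p (c • w) z := by
  ext i
  simp only [siegel_apply, QMinusEven_smul,
    polarForm_smul_right, Pi.add_apply, Pi.smul_apply, smul_eq_mul]
  ring

theorem siegel_comm {p w : Fin 8 → F} (hp : QMinusEven a p = 0) (hw : QMinusEven a w = 0)
    (z : Fin 8 → F) : siegel a p w z = siegel a w p z := by
  ext i
  simp only [siegel_apply, hp, hw, Pi.add_apply, Pi.smul_apply, smul_eq_mul]
  ring

section

variable {H : Subgroup (GL (Fin 8) F)} {p w : Fin 8 → F}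

theorem HasSiegel.zero (hp : QMinusEven a p = 0) : HasSiegel a H p 0 :=
  ⟨hp, polarForm_zero_right p, 1, H.one_mem, fun z => by simp [siegel_zero]⟩

theorem HasSiegel.of_smul_left {c : F} (hc : c ≠ 0) (h : HasSiegel a H (c • p) w) :
    HasSiegel a H p (c • w) := by
  obtain ⟨hp, hw, g, hg, hgz⟩ := h
  refine ⟨?_, ?_, g, hg, fun z => ?_⟩
  · rw [QMinusEven_smul] at hp
    exact (mul_eq_zero.1 hp).resolve_left (pow_ne_zero 2 hc)
  · rwa [polarForm_smul_right, ← polarForm_smul_left]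
  · rw [hgz, siegel_smul_left]

theorem HasSiegel.symm (h : HasSiegel a H p w) (hw : QMinusEven a w = 0) : HasSiegel a H w p := by
  obtain ⟨hp, hpw, g, hg, hgz⟩ := h
  exact ⟨hw, by rwa [polarForm_comm], g, hg, fun z => by rw [hgz, siegel_comm hp hw]⟩

end

variable [CharP F 2]

theorem QMinusEven_siegel {p w : Fin 8 → F} (hp : QMinusEven a p = 0) (hw : polarForm p w = 0)
    (z : Fin 8 → F) : QMinusEven a (siegel a p w z) = QMinusEven a z := by
  have h2 : (2 : F) = 0 := two_eq_zero_of_charTwo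
  simp only [siegel_apply, QMinusEven_add, QMinusEven_smul, polarForm_add_left,
    polarForm_smul_left, polarForm_smul_right, hp, polarForm_comm w p, hw]
  linear_combination (QMinusEven a w * polarForm z p ^ 2 + polarForm z p * polarForm z w) * h2

theorem exists_orthogonal_siegel {p w : Fin 8 → F} (hp : QMinusEven a p = 0)
    (hw : polarForm p w = 0) :
    ∃ g ∈ orthogonalGroupOf F (QMinusEven a), ∀ z, g.1 *ᵥ z = siegel a p w z :=
  exists_orthogonal_of_linearMap _ (QMinusEven_siegel hp hw)

theorem hasSiegel_orthogonalGroupOf {p w : Fin 8 → F} (hp : QMinusEven a p = 0)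
    (hw : polarForm p w = 0) : HasSiegel a (orthogonalGroupOf F (QMinusEven a)) p w :=
  ⟨hp, hw, exists_orthogonal_siegel hp hw⟩

theorem siegel_siegel {p w w' : Fin 8 → F} (hw : polarForm p w = 0)
    (hw' : polarForm p w' = 0) (z : Fin 8 → F) :
    siegel a p w (siegel a p w' z) = siegel a p (w + w') z := by
  ext i
  simp only [siegel_apply, QMinusEven_add, polarForm_add_left, polarForm_add_right,
    polarForm_smul_left, polarForm_self, hw, hw', polarForm_comm w' p,
    Pi.add_apply, Pi.smul_apply, smul_eq_mul, polarForm_comm w' w]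
  ring

theorem siegel_involutive {p w : Fin 8 → F} (hw : polarForm p w = 0)
    (z : Fin 8 → F) : siegel a p w (siegel a p w z) = z := by
  rw [siegel_siegel hw hw, add_self_charTwo, siegel_zero]

theorem siegel_add_smul {p w : Fin 8 → F} (hp : QMinusEven a p = 0)
    (hw : polarForm p w = 0) (c : F) (z : Fin 8 → F) :
    siegel a p (w + c • p) z = siegel a p w z := by
  have h2 : (2 : F) = 0 := two_eq_zero_of_charTwo
  ext i
  simp only [siegel_apply, QMinusEven_add, QMinusEven_smul, polarForm_add_right,
    polarForm_smul_right, hp, hw, polarForm_comm w p, Pi.add_apply, Pi.smul_apply, smul_eq_mul]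
  linear_combination (c * polarForm z p * p i) * h2

theorem mulVec_siegel {g : GL (Fin 8) F} (hg : g ∈ orthogonalGroupOf F (QMinusEven a))
    (p w z : Fin 8 → F) :
    g.1 *ᵥ siegel a p w z = siegel a (g.1 *ᵥ p) (g.1 *ᵥ w) (g.1 *ᵥ z) := by
  simp only [siegel_apply, mulVec_add, mulVec_smul, polarForm_mulVec hg,
    mem_orthogonalGroupOf.1 hg]

namespace HasSiegel

variable {H : Subgroup (GL (Fin 8) F)} {p w w' : Fin 8 → F}

theorem add (h : HasSiegel a H p w) (h' : HasSiegel a H p w') : HasSiegel a H p (w + w') := by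
  obtain ⟨hp, hw, g, hg, hgz⟩ := h
  obtain ⟨-, hw', g', hg', hgz'⟩ := h'
  refine ⟨hp, by rw [polarForm_add_right, hw, hw', add_zero], g * g', H.mul_mem hg hg', fun z => ?_⟩
  rw [gl_mul_mulVec, hgz', hgz, siegel_siegel hw hw']

theorem add_smul_self (h : HasSiegel a H p w) (c : F) : HasSiegel a H p (w + c • p) := by
  obtain ⟨hp, hw, g, hg, hgz⟩ := h
  refine ⟨hp, by rw [polarForm_add_right, hw, polarForm_smul_right, polarForm_self]; simp,
    g, hg, fun z => ?_⟩
  rw [hgz, siegel_add_smul hp hw]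

theorem smul_self (hp : QMinusEven a p = 0) (c : F) : HasSiegel a H p (c • p) := by
  simpa using (zero (H := H) hp).add_smul_self c

/-- Cancelling a known summand. -/
theorem of_add (h : HasSiegel a H p (w + w')) (h' : HasSiegel a H p w') : HasSiegel a H p w := by
  have := h.add h'
  rwa [add_assoc, add_self_charTwo, add_zero] at this

theorem conj (hH : H ≤ orthogonalGroupOf F (QMinusEven a)) (h : HasSiegel a H p w)
    {k : GL (Fin 8) F} (hk : k ∈ H) : HasSiegel a H (k.1 *ᵥ p) (k.1 *ᵥ w) := by
  obtain ⟨hp, hw, g, hg, hgz⟩ := h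
  refine ⟨by rw [mem_orthogonalGroupOf.1 (hH hk), hp], by rw [polarForm_mulVec (hH hk), hw],
    k * g * k⁻¹, H.mul_mem (H.mul_mem hk hg) (H.inv_mem hk), fun z => ?_⟩
  rw [gl_mul_mulVec, gl_mul_mulVec, hgz, mulVec_siegel (hH hk), gl_mulVec_inv_mulVec]

/-- Conjugating one Siegel transformation in `H` by another one. -/
theorem conj_siegel (hH : H ≤ orthogonalGroupOf F (QMinusEven a)) (h : HasSiegel a H p w)
    {p' w' : Fin 8 → F} (h' : HasSiegel a H p' w') :
    HasSiegel a H (siegel a p' w' p) (siegel a p' w' w) := by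
  obtain ⟨-, -, k, hk, hkz⟩ := h'
  have := h.conj hH hk
  rwa [hkz, hkz] at this

/-- Splitting the singular argument along a totally singular plane orthogonal to `w`. -/
theorem of_add_left (h : HasSiegel a H (p + w') w) (h' : HasSiegel a H p w)
    (hs : HasSiegel a H p (QMinusEven a w • w')) (hw' : QMinusEven a w' = 0) :
    HasSiegel a H w' w := by
  have h2 : (2 : F) = 0 := two_eq_zero_of_charTwo
  obtain ⟨hpp, hpw, g, hg, hgz⟩ := h
  obtain ⟨hp, hw, k, hk, hkz⟩ := h'
  obtain ⟨-, -, l, hl, hlz⟩ := hs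
  have h3 : polarForm w' w = 0 := by rwa [polarForm_add_left, hw, zero_add] at hpw
  have h4 : polarForm p w' = 0 := by rwa [QMinusEven_add, hp, hw', zero_add, zero_add] at hpp
  refine ⟨hw', h3, g * k * l, H.mul_mem (H.mul_mem hg hk) hl, fun z => ?_⟩
  rw [gl_mul_mulVec, gl_mul_mulVec, hlz, hkz, hgz]
  ext i
  simp only [siegel_apply, polarForm_add_left, polarForm_add_right, QMinusEven_smul, hw',
    polarForm_smul_left, polarForm_smul_right, polarForm_self, polarForm_comm w' p,
    polarForm_comm w p, polarForm_comm w w', h3, h4, hw,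
    Pi.add_apply, Pi.smul_apply, smul_eq_mul]
  grind

end HasSiegel

end Siegel

section Generation

variable {F : Type*} [Field F] {a : F}

/-- The reflection in a nonsingular vector. -/
def reflectionMap (a : F) (n : Fin 8 → F) : (Fin 8 → F) →ₗ[F] (Fin 8 → F) where
  toFun z := z + ((QMinusEven a n)⁻¹ * polarForm z n) • n
  map_add' u v := by
    ext i
    simp only [polarForm_add_left, Pi.add_apply, Pi.smul_apply, smul_eq_mul]
    ring
  map_smul' c u := by
    ext i
    simp only [polarForm_smul_left, Pi.add_apply, Pi.smul_apply, smul_eq_mul, RingHom.id_apply]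
    ring

theorem reflectionMap_apply (a : F) (n z : Fin 8 → F) :
    reflectionMap a n z = z + ((QMinusEven a n)⁻¹ * polarForm z n) • n := rfl

theorem reflectionMap_smul {c : F} (hc : c ≠ 0) (n z : Fin 8 → F) :
    reflectionMap a (c • n) z = reflectionMap a n z := by
  ext i
  simp only [reflectionMap_apply, QMinusEven_smul, polarForm_smul_right, Pi.add_apply,
    Pi.smul_apply, smul_eq_mul, mul_inv]
  field_simp

theorem HasSiegel.of_zero_left {H : Subgroup (GL (Fin 8) F)} (w : Fin 8 → F) :
    HasSiegel a H 0 w := by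
  refine ⟨by simp [QMinusEven], by rw [polarForm_comm, polarForm_zero_right], 1, H.one_mem,
    fun z => ?_⟩
  simp [siegel_apply, polarForm_zero_right]

variable [CharP F 2]

/-- Two full opposite Siegel groups generate all Siegel transformations. -/
theorem hasSiegel_of_opposite {H : Subgroup (GL (Fin 8) F)}
    (hH : H ≤ orthogonalGroupOf F (QMinusEven a)) {o o' : Fin 8 → F}
    (ho : QMinusEven a o = 0) (ho' : QMinusEven a o' = 0) (hoo : polarForm o o' ≠ 0)
    (h : ∀ w, polarForm o w = 0 → HasSiegel a H o w)
    (h' : ∀ w, polarForm o' w = 0 → HasSiegel a H o' w)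
    {p w : Fin 8 → F} (hp : QMinusEven a p = 0) (hpw : polarForm p w = 0) :
    HasSiegel a H p w := by
  have h2 : (2 : F) = 0 := two_eq_zero_of_charTwo
  have smul_case : ∀ {p : Fin 8 → F} {c : F}, c ≠ 0 →
      (∀ w, polarForm (c • p) w = 0 → HasSiegel a H (c • p) w) →
      ∀ w, polarForm p w = 0 → HasSiegel a H p w := by
    intro p c hc hcp w hw
    have := (hcp (c⁻¹ • w) (by
      rw [polarForm_smul_left, polarForm_smul_right, hw]; simp)).of_smul_left hc
    rwa [smul_smul, mul_inv_cancel₀ hc, one_smul] at this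
  have conj_case : ∀ {p : Fin 8 → F} {k : GL (Fin 8) F}, k ∈ H →
      (∀ w, polarForm p w = 0 → HasSiegel a H p w) →
      ∀ w, polarForm (k.1 *ᵥ p) w = 0 → HasSiegel a H (k.1 *ᵥ p) w := by
    intro p k hk hkp w hw
    have hw' := polarForm_mulVec (hH hk) p ((k⁻¹).1 *ᵥ w)
    rw [gl_mulVec_inv_mulVec, hw] at hw'
    have := (hkp _ hw'.symm).conj hH hk
    rwa [gl_mulVec_inv_mulVec] at this
  have opposite_case : ∀ {o o' : Fin 8 → F}, QMinusEven a o' = 0 →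
      polarForm o o' ≠ 0 → (∀ w, polarForm o w = 0 → HasSiegel a H o w) →
      (∀ w, polarForm o' w = 0 → HasSiegel a H o' w) →
      ∀ {p : Fin 8 → F}, QMinusEven a p = 0 → polarForm p o ≠ 0 →
      ∀ w, polarForm p w = 0 → HasSiegel a H p w := by
    intro o o' ho' hoo h h' p hp hpo
    set β := polarForm o o' with hβ
    set γ := polarForm p o with hγ
    have hop : polarForm o p = γ := by rw [polarForm_comm]
    have hc : β / γ ≠ 0 := div_ne_zero hoo hpo
    have hw : polarForm o (β⁻¹ • ((β / γ) • p + o')) = 0 := by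
      rw [polarForm_smul_right, polarForm_add_right, polarForm_smul_right, hop, ← hβ,
        div_mul_cancel₀ _ hpo]
      linear_combination β⁻¹ * β * h2
    obtain ⟨-, -, k, hk, hkz⟩ := h _ hw
    have hko : k.1 *ᵥ o' = (β / γ) • p := by
      rw [hkz]
      ext i
      simp only [siegel_apply, QMinusEven_smul, QMinusEven_add, hp, ho', polarForm_smul_left,
        polarForm_smul_right, polarForm_add_right, polarForm_self, polarForm_comm o' o, ← hβ,
        polarForm_comm o' p, Pi.add_apply, Pi.smul_apply, smul_eq_mul]
      field_simp
      linear_combination β * (o' i * γ ^ 2 + polarForm p o' * o i * γ) * h2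
    refine smul_case hc ?_
    rw [← hko]
    exact conj_case hk h'
  by_cases h1 : polarForm p o = 0
  · by_cases h3 : polarForm p o' = 0
    · by_cases h4 : p = 0
      · rw [h4]; exact HasSiegel.of_zero_left w
      have hpo : p ∉ Submodule.span F {o} := by
        intro hm
        obtain ⟨c, rfl⟩ := Submodule.mem_span_singleton.1 hm
        rw [polarForm_smul_left] at h3
        rcases mul_eq_zero.1 h3 with h5 | h5
        · exact h4 (by rw [h5, zero_smul])
        · exact hoo h5
      obtain ⟨u, hu, hpu⟩ := exists_orthogonal_of_notMem hpo
      obtain ⟨-, -, k, hk, hkz⟩ := h u (hu o (Submodule.mem_span_singleton_self o))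
      have hkp : k.1 *ᵥ p = p + o := by
        rw [hkz, siegel_apply, h1, hpu]; simp
      have hfin := opposite_case (p := p + o) ho (by rwa [polarForm_comm]) h' h
        (by rw [QMinusEven_add, hp, ho, h1]; simp) (by rwa [polarForm_add_left, h3, zero_add])
      rw [← hkp] at hfin
      have := conj_case (H.inv_mem hk) hfin
      rw [gl_inv_mulVec_mulVec] at this
      exact this w hpw
    · exact opposite_case ho (by rwa [polarForm_comm]) h' h hp h3 w hpw
  · exact opposite_case ho' hoo h h' hp h1 w hpw

theorem exists_orthogonal_reflection {n : Fin 8 → F} (hn : QMinusEven a n ≠ 0) :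
    ∃ g ∈ orthogonalGroupOf F (QMinusEven a), ∀ z, g.1 *ᵥ z = reflectionMap a n z := by
  have h2 : (2 : F) = 0 := two_eq_zero_of_charTwo
  refine exists_orthogonal_of_linearMap _ fun z => ?_
  simp only [reflectionMap_apply, QMinusEven_add, QMinusEven_smul, polarForm_smul_right]
  field_simp
  linear_combination polarForm z n ^ 2 * h2

theorem mulVec_reflectionMap {g : GL (Fin 8) F} (hg : g ∈ orthogonalGroupOf F (QMinusEven a))
    (n z : Fin 8 → F) :
    g.1 *ᵥ reflectionMap a n z = reflectionMap a (g.1 *ᵥ n) (g.1 *ᵥ z) := by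
  simp only [reflectionMap_apply, mulVec_add, mulVec_smul, polarForm_mulVec hg,
    mem_orthogonalGroupOf.1 hg]

/-- An element of the orthogonal group moving some vector can be multiplied by a reflection or
a Siegel transformation so as to fix more vectors. -/
theorem exists_mul_fix_more {g : GL (Fin 8) F} (hg : g ∈ orthogonalGroupOf F (QMinusEven a))
    (hg1 : g ≠ 1) :
    ∃ s ∈ orthogonalGroupOf F (QMinusEven a),
      ((∃ n, QMinusEven a n ≠ 0 ∧ ∀ z, s.1 *ᵥ z = reflectionMap a n z) ∨
        ∃ p w, QMinusEven a p = 0 ∧ polarForm p w = 0 ∧ ∀ z, s.1 *ᵥ z = siegel a p w z) ∧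
      (∀ z, g.1 *ᵥ z = z → s.1 *ᵥ z = z) ∧
      ∃ v, g.1 *ᵥ v ≠ v ∧ s.1 *ᵥ (g.1 *ᵥ v) = v := by
  have h2 : (2 : F) = 0 := two_eq_zero_of_charTwo
  have hQ := mem_orthogonalGroupOf.1 hg
  have hQd : ∀ v, QMinusEven a (g.1 *ᵥ v + v) = polarForm (g.1 *ᵥ v) v := fun v => by
    rw [QMinusEven_add, hQ]; linear_combination QMinusEven a v * h2
  have hBd : ∀ v, polarForm (g.1 *ᵥ v) (g.1 *ᵥ v + v) = polarForm (g.1 *ᵥ v) v := fun v => by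
    rw [polarForm_add_right, polarForm_self, zero_add]
  have hXd : ∀ z, g.1 *ᵥ z = z → ∀ v, polarForm z (g.1 *ᵥ v + v) = 0 := fun z hz v => by
    have := polarForm_mulVec hg z v
    rw [hz] at this
    rw [polarForm_add_right, this]
    linear_combination polarForm z v * h2
  have hvd : ∀ v, g.1 *ᵥ v + (g.1 *ᵥ v + v) = v := fun v => by
    rw [← add_assoc, add_self_charTwo, zero_add]
  by_cases hcase : ∃ v, QMinusEven a (g.1 *ᵥ v + v) ≠ 0
  · obtain ⟨v, hv⟩ := hcase
    obtain ⟨s, hs, hsz⟩ := exists_orthogonal_reflection hv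
    refine ⟨s, hs, Or.inl ⟨_, hv, hsz⟩, fun z hz => ?_, v, fun hfix => hv ?_, ?_⟩
    · rw [hsz, reflectionMap_apply, hXd z hz]; simp
    · rw [hfix, add_self_charTwo]; simp [QMinusEven]
    · rw [hsz, reflectionMap_apply, hBd, ← hQd, inv_mul_cancel₀ hv, one_smul, hvd]
  push Not at hcase
  let X : Submodule F (Fin 8 → F) :=
    { carrier := {z | g.1 *ᵥ z = z}
      add_mem' := fun {u v} hu hv => by
        simp only [Set.mem_ofPred_eq] at *
        rw [mulVec_add, hu, hv]
      zero_mem' := by simp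
      smul_mem' := fun c u hu => by
        simp only [Set.mem_ofPred_eq] at *
        rw [mulVec_smul, hu] }
  by_cases hcase2 : ∃ v, v ∉ Submodule.span F {g.1 *ᵥ v + v} ⊔ X
  · obtain ⟨v, hv⟩ := hcase2
    obtain ⟨w, hw, hvw⟩ := exists_orthogonal_of_notMem hv
    have hdw : polarForm (g.1 *ᵥ v + v) w = 0 :=
      hw _ (Submodule.mem_sup_left (Submodule.mem_span_singleton_self _))
    obtain ⟨s, hs, hsz⟩ := exists_orthogonal_siegel (hcase v) hdw
    refine ⟨s, hs, Or.inr ⟨_, _, hcase v, hdw, hsz⟩, fun z hz => ?_, v,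
      fun hfix => hv (Submodule.mem_sup_right hfix), ?_⟩
    · rw [hsz, siegel_apply, hXd z hz, hw z (Submodule.mem_sup_right hz)]; simp
    · have hgw : polarForm (g.1 *ᵥ v) w = 1 := by
        rw [polarForm_add_left, hvw] at hdw
        linear_combination hdw - h2
      rw [hsz, siegel_apply, hBd, ← hQd, hcase v, hgw]
      simp [hvd]
  push Not at hcase2
  exfalso
  apply hg1
  refine gl_ext fun u => ?_
  have hdd : ∀ u v, polarForm (g.1 *ᵥ u + u) (g.1 *ᵥ v + v) = 0 := fun u v => by
    have h := QMinusEven_add a (g.1 *ᵥ u + u) (g.1 *ᵥ v + v)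
    have h' : g.1 *ᵥ u + u + (g.1 *ᵥ v + v) = g.1 *ᵥ (u + v) + (u + v) := by
      rw [mulVec_add]; abel
    rw [h', hcase, hcase, hcase, zero_add, zero_add] at h
    exact h.symm
  have hd0 : g.1 *ᵥ u + u = 0 := by
    refine eq_zero_of_polarForm_eq_zero fun v => ?_
    obtain ⟨s, hs, x, hx, hsx⟩ := Submodule.mem_sup.1 (hcase2 v)
    obtain ⟨c, rfl⟩ := Submodule.mem_span_singleton.1 hs
    rw [← hsx, polarForm_add_right, polarForm_smul_right, hdd, mul_zero, zero_add,
      polarForm_comm, hXd x hx]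
  rw [Units.val_one, one_mulVec]
  have := hvd u
  rwa [hd0, add_zero] at this

/-- The orthogonal group is generated by reflections and Siegel transformations. -/
theorem orthogonalGroupOf_le_of_reflections_of_siegels {S : Subgroup (GL (Fin 8) F)}
    (hrefl : ∀ s : GL (Fin 8) F, ∀ n, QMinusEven a n ≠ 0 →
      (∀ z, s.1 *ᵥ z = reflectionMap a n z) → s ∈ S)
    (hsieg : ∀ s : GL (Fin 8) F, ∀ p w, QMinusEven a p = 0 → polarForm p w = 0 →
      (∀ z, s.1 *ᵥ z = siegel a p w z) → s ∈ S) :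
    orthogonalGroupOf F (QMinusEven a) ≤ S := by
  let fix : GL (Fin 8) F → Submodule F (Fin 8 → F) := fun g =>
    LinearMap.ker (g.1.mulVecLin - LinearMap.id)
  have mem_fix : ∀ g z, z ∈ fix g ↔ g.1 *ᵥ z = z := fun g z => by
    simp [fix, LinearMap.mem_ker, sub_eq_zero]
  suffices H : ∀ X : Submodule F (Fin 8 → F), ∀ g ∈ orthogonalGroupOf F (QMinusEven a),
      fix g = X → g ∈ S from fun g hg => H _ g hg rfl
  intro X
  induction X using WellFoundedGT.induction with
  | ind X ih =>
    rintro g hg rfl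
    by_cases hg1 : g = 1
    · rw [hg1]; exact S.one_mem
    obtain ⟨s, hs, hkind, hfix, v, hv, hsv⟩ := exists_mul_fix_more hg hg1
    have hsS : s ∈ S := by
      rcases hkind with ⟨n, hn, hz⟩ | ⟨p, w, hp, hw, hz⟩
      · exact hrefl s n hn hz
      · exact hsieg s p w hp hw hz
    have hlt : fix g < fix (s * g) := by
      refine lt_of_le_of_ne (fun z hz => ?_) fun heq => hv ?_
      · rw [mem_fix] at *
        rw [gl_mul_mulVec, hz, hfix z hz]
      · rw [← mem_fix, heq, mem_fix, gl_mul_mulVec, hsv]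
    have := ih _ hlt (s * g) (Subgroup.mul_mem _ hs hg) rfl
    exact (S.mul_mem_cancel_left hsS).1 this

end Generation

section Commutator

variable {F : Type*} [Field F] {a : F}

/-- The subgroup generated by all Siegel transformations. -/
def siegelSubgroup (a : F) : Subgroup (GL (Fin 8) F) :=
  Subgroup.closure {g | ∃ p w, QMinusEven a p = 0 ∧ polarForm p w = 0 ∧
    ∀ z, g.1 *ᵥ z = siegel a p w z}

theorem siegel_mem_siegelSubgroup {g : GL (Fin 8) F} {p w : Fin 8 → F}
    (hp : QMinusEven a p = 0) (hw : polarForm p w = 0) (hg : ∀ z, g.1 *ᵥ z = siegel a p w z) :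
    g ∈ siegelSubgroup a :=
  Subgroup.subset_closure ⟨p, w, hp, hw, hg⟩

theorem siegelSubgroup_le {S : Subgroup (GL (Fin 8) F)}
    (hS : ∀ p w, QMinusEven a p = 0 → polarForm p w = 0 → HasSiegel a S p w) :
    siegelSubgroup a ≤ S := by
  refine (Subgroup.closure_le _).2 ?_
  rintro g ⟨p, w, hp, hw, hg⟩
  obtain ⟨-, -, k, hk, hkz⟩ := hS p w hp hw
  rwa [show g = k from gl_ext fun z => by rw [hg, hkz]]

variable [CharP F 2]

theorem siegelSubgroup_le_orthogonalGroupOf :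
    siegelSubgroup a ≤ orthogonalGroupOf F (QMinusEven a) :=
  siegelSubgroup_le fun _ _ hp hw => hasSiegel_orthogonalGroupOf hp hw

theorem conj_mem_siegelSubgroup {g k : GL (Fin 8) F}
    (hg : g ∈ orthogonalGroupOf F (QMinusEven a)) (hk : k ∈ siegelSubgroup a) :
    g * k * g⁻¹ ∈ siegelSubgroup a := by
  have : siegelSubgroup a ≤ (siegelSubgroup a).comap (MulAut.conj g).toMonoidHom := by
    refine (Subgroup.closure_le _).2 ?_
    rintro k ⟨p, w, hp, hw, hk⟩
    refine siegel_mem_siegelSubgroup (p := g.1 *ᵥ p) (w := g.1 *ᵥ w)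
      (by rw [mem_orthogonalGroupOf.1 hg, hp]) (by rw [polarForm_mulVec hg, hw]) fun z => ?_
    change (g * k * g⁻¹).1 *ᵥ z = _
    rw [gl_mul_mulVec, gl_mul_mulVec, hk, mulVec_siegel hg, gl_mulVec_inv_mulVec]
  exact this hk

/-- Two vectors have a common orthogonal nonsingular vector. -/
theorem exists_nonsingular_orthogonal (a : F) (n m : Fin 8 → F) :
    ∃ u, polarForm n u = 0 ∧ polarForm m u = 0 ∧ QMinusEven a u ≠ 0 := by
  by_contra! hc
  let φ : (Fin 8 → F) →ₗ[F] F × F := (polarLin n).prod (polarLin m)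
  have hker : ∀ z, z ∈ LinearMap.ker φ ↔ polarForm n z = 0 ∧ polarForm m z = 0 := fun z => by
    simp [φ, LinearMap.mem_ker]
  have hle : LinearMap.ker φ ≤ Submodule.span F {n, m} := by
    intro z hz
    by_contra hzn
    obtain ⟨w, hw, hzw⟩ := exists_orthogonal_of_notMem hzn
    have hw1 := hw n (Submodule.subset_span (by simp))
    have hw2 := hw m (Submodule.subset_span (by simp))
    obtain ⟨hz1, hz2⟩ := (hker z).1 hz
    have := hc (z + w) (by rw [polarForm_add_right, hz1, hw1, add_zero])
      (by rw [polarForm_add_right, hz2, hw2, add_zero])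
    rw [QMinusEven_add, hc z hz1 hz2, hc w hw1 hw2, hzw] at this
    simp at this
  have h1 := LinearMap.finrank_range_add_finrank_ker φ
  have h3 : Module.finrank F (LinearMap.range φ) ≤ 2 := by
    simpa using Submodule.finrank_le (LinearMap.range φ)
  have h4 : Module.finrank F (LinearMap.ker φ) ≤ 2 := by
    classical
    refine (Submodule.finrank_mono hle).trans ((finrank_span_le_card _).trans ?_)
    rw [Set.toFinset_insert, Set.toFinset_singleton]
    exact Finset.card_le_two
  simp at h1
  omega

theorem exists_siegelSubgroup_mulVec_of_orthogonal {n m : Fin 8 → F} (hn : QMinusEven a n = 1)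
    (hm : QMinusEven a m = 1) (hnm : polarForm n m = 0) :
    ∃ k ∈ siegelSubgroup a, k.1 *ᵥ n = m := by
  have h2 : (2 : F) = 0 := two_eq_zero_of_charTwo
  have hQ : QMinusEven a (n + m) = 0 := by
    rw [QMinusEven_add, hn, hm, hnm]; linear_combination h2
  have hmem : n ∉ Submodule.span F {n + m} := by
    intro h
    obtain ⟨c, hc⟩ := Submodule.mem_span_singleton.1 h
    rw [← hc, QMinusEven_smul, hQ] at hn
    simp at hn
  obtain ⟨w, hw, hnw⟩ := exists_orthogonal_of_notMem hmem
  have hw' := hw _ (Submodule.mem_span_singleton_self _)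
  obtain ⟨g, -, hg⟩ := exists_orthogonal_siegel hQ hw'
  refine ⟨g, siegel_mem_siegelSubgroup hQ hw' hg, ?_⟩
  rw [hg, siegel_apply, polarForm_add_right, polarForm_self, hnm, hnw]
  simp [← add_assoc, add_self_charTwo]

/-- Siegel transformations are commutators once the field has more than two elements. -/
theorem siegelSubgroup_le_commutator {μ : F} (hμ : μ ≠ 0) (hμ1 : μ + 1 ≠ 0) :
    siegelSubgroup a ≤
      ⁅orthogonalGroupOf F (QMinusEven a), orthogonalGroupOf F (QMinusEven a)⁆ := by
  have h2 : (2 : F) = 0 := two_eq_zero_of_charTwo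
  refine siegelSubgroup_le fun p w hp hw => ?_
  by_cases hp0 : p = 0
  · rw [hp0]; exact HasSiegel.of_zero_left w
  obtain ⟨u, hu⟩ := exists_polarForm_ne_zero hp0
  obtain ⟨v, hv⟩ : ∃ v, polarForm p v = 1 :=
    ⟨(polarForm p u)⁻¹ • u, by rw [polarForm_smul_right, inv_mul_cancel₀ hu]⟩
  obtain ⟨q, hpq, hq⟩ : ∃ q, polarForm p q = 1 ∧ QMinusEven a q = 0 := by
    refine ⟨v + QMinusEven a v • p, ?_, ?_⟩
    · rw [polarForm_add_right, polarForm_smul_right, polarForm_self, hv]; simp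
    · rw [QMinusEven_add, QMinusEven_smul, polarForm_smul_right, hp, polarForm_comm v, hv]
      linear_combination QMinusEven a v * h2
  let f : (Fin 8 → F) →ₗ[F] (Fin 8 → F) :=
    LinearMap.id + (μ + 1) • (polarLin q).smulRight p + (μ⁻¹ + 1) • (polarLin p).smulRight q
  have hf : ∀ z, f z = z + ((μ + 1) * polarForm q z) • p + ((μ⁻¹ + 1) * polarForm p z) • q :=
    fun z => by simp [f, smul_smul]
  obtain ⟨h, hh, hhz⟩ := exists_orthogonal_of_linearMap (a := a) f fun z => by
    simp only [hf, QMinusEven_add, QMinusEven_smul, polarForm_add_left, polarForm_smul_left,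
      polarForm_smul_right, hp, hq, hpq, polarForm_comm z]
    field_simp
    linear_combination (μ ^ 3 + 2 * μ ^ 2 + μ) * polarForm q z * polarForm p z * h2
  obtain ⟨w', hw', hqw', hww'⟩ : ∃ w', polarForm p w' = 0 ∧ polarForm q w' = 0 ∧
      w = (μ + 1) • w' + polarForm q w • p := by
    refine ⟨(μ + 1)⁻¹ • (w + polarForm q w • p), ?_, ?_, ?_⟩
    · rw [polarForm_smul_right, polarForm_add_right, hw, polarForm_smul_right, polarForm_self]
      simp
    · rw [polarForm_smul_right, polarForm_add_right, polarForm_smul_right, polarForm_comm q p, hpq]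
      linear_combination (μ + 1)⁻¹ * polarForm q w * h2
    · rw [smul_smul, mul_inv_cancel₀ hμ1, one_smul, add_assoc, add_self_charTwo, add_zero]
  rw [hww']
  refine HasSiegel.add_smul_self ?_ _
  obtain ⟨g, hg, hgz⟩ := exists_orthogonal_siegel hp hw'
  refine ⟨hp, by rw [polarForm_smul_right, hw', mul_zero], h * g * h⁻¹ * g⁻¹,
    Subgroup.commutator_mem_commutator hh hg, fun z => ?_⟩
  have hginv : g⁻¹ = g := inv_eq_of_mul_eq_one_left (gl_ext fun z => by
    rw [gl_mul_mulVec, hgz, hgz, siegel_involutive hw', Units.val_one, one_mulVec])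
  have hhp : h.1 *ᵥ p = μ • p := by
    rw [hhz, hf, polarForm_self, polarForm_comm q p, hpq]
    ext i
    simp only [Pi.add_apply, Pi.smul_apply, smul_eq_mul]
    linear_combination p i * h2
  have hhw : h.1 *ᵥ w' = w' := by
    rw [hhz, hf, hw', hqw']; simp
  rw [hginv, gl_mul_mulVec, gl_mul_mulVec, gl_mul_mulVec, hgz, hgz,
    mulVec_siegel hh, gl_mulVec_inv_mulVec, hhp, hhw, siegel_smul_left,
    siegel_siegel (by rw [polarForm_smul_right, hw', mul_zero]) hw', add_smul, one_smul]

variable [Finite F]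

theorem exists_sq_eq_of_charTwo (c : F) : ∃ d, d ^ 2 = c := by
  have := Fintype.ofFinite F
  obtain ⟨d, hd⟩ := FiniteField.isSquare_of_char_two (ringChar.eq F 2) c
  exact ⟨d, by rw [hd, sq]⟩

/-- A nonsingular vector can be rescaled to have norm one. -/
theorem exists_smul_norm_one {n : Fin 8 → F} (hn : QMinusEven a n ≠ 0) :
    ∃ c : F, c ≠ 0 ∧ QMinusEven a (c • n) = 1 := by
  obtain ⟨d, hd⟩ := exists_sq_eq_of_charTwo (QMinusEven a n)⁻¹
  refine ⟨d, fun h => ?_, by rw [QMinusEven_smul, hd, inv_mul_cancel₀ hn]⟩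
  rw [h] at hd
  exact inv_ne_zero hn (by rw [← hd]; ring)

theorem exists_siegelSubgroup_mulVec {n m : Fin 8 → F} (hn : QMinusEven a n = 1)
    (hm : QMinusEven a m = 1) : ∃ k ∈ siegelSubgroup a, k.1 *ᵥ n = m := by
  obtain ⟨u, hnu, hmu, hu⟩ := exists_nonsingular_orthogonal a n m
  obtain ⟨c, -, hcu⟩ := exists_smul_norm_one hu
  obtain ⟨k, hk, hkn⟩ := exists_siegelSubgroup_mulVec_of_orthogonal hn hcu
    (by rw [polarForm_smul_right, hnu, mul_zero])
  obtain ⟨l, hl, hlu⟩ := exists_siegelSubgroup_mulVec_of_orthogonal hcu hm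
    (by rw [polarForm_smul_left, polarForm_comm, hmu, mul_zero])
  exact ⟨l * k, Subgroup.mul_mem _ hl hk, by rw [gl_mul_mulVec, hkn, hlu]⟩

/-- The Siegel subgroup has index at most two in the orthogonal group, and the nontrivial coset
is represented by any reflection. -/
theorem exists_mem_siegelSubgroup_or_mul_mem (a : F) :
    ∃ r ∈ orthogonalGroupOf F (QMinusEven a), ∀ g ∈ orthogonalGroupOf F (QMinusEven a),
      g ∈ siegelSubgroup a ∨ g * r⁻¹ ∈ siegelSubgroup a := by
  obtain ⟨n, -, -, hn⟩ := exists_nonsingular_orthogonal a 0 0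
  obtain ⟨c, hc, hcn⟩ := exists_smul_norm_one hn
  obtain ⟨r, hr, hrz⟩ := exists_orthogonal_reflection (a := a) (n := c • n) (by rw [hcn]; simp)
  have hrr : r * r = 1 := gl_ext fun z => by
    have h2 : (2 : F) = 0 := two_eq_zero_of_charTwo
    rw [gl_mul_mulVec, hrz, hrz, Units.val_one, one_mulVec]
    ext i
    simp only [reflectionMap_apply, hcn, polarForm_add_left, polarForm_smul_left,
      Pi.add_apply, Pi.smul_apply, smul_eq_mul]
    simp only [polarForm_smul_right, polarForm_self]
    linear_combination (c * polarForm z n * (c * n i)) * h2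
  have hrinv : r⁻¹ = r := inv_eq_of_mul_eq_one_left hrr
  let K := siegelSubgroup a
  let S : Subgroup (GL (Fin 8) F) :=
    { carrier := {g | g ∈ orthogonalGroupOf F (QMinusEven a) ∧ (g ∈ K ∨ g * r⁻¹ ∈ K)}
      one_mem' := ⟨Subgroup.one_mem _, Or.inl K.one_mem⟩
      mul_mem' := by
        rintro g h ⟨hg, hgK⟩ ⟨hh, hhK⟩
        refine ⟨Subgroup.mul_mem _ hg hh, ?_⟩
        rcases hgK with hgK | hgK <;> rcases hhK with hhK | hhK
        · exact Or.inl (K.mul_mem hgK hhK)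
        · right; rw [mul_assoc]; exact K.mul_mem hgK hhK
        · right
          have := K.mul_mem hgK (conj_mem_siegelSubgroup hr hhK)
          rwa [show g * r⁻¹ * (r * h * r⁻¹) = g * h * r⁻¹ by group] at this
        · left
          have := K.mul_mem hgK (conj_mem_siegelSubgroup hr hhK)
          rwa [show g * r⁻¹ * (r * (h * r⁻¹) * r⁻¹) = g * h * (r⁻¹ * r⁻¹) by group, hrinv, hrr,
            mul_one] at this
      inv_mem' := by
        rintro g ⟨hg, hgK⟩
        refine ⟨Subgroup.inv_mem _ hg, ?_⟩
        rcases hgK with hgK | hgK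
        · exact Or.inl (K.inv_mem hgK)
        · right
          have := conj_mem_siegelSubgroup (Subgroup.inv_mem _ hr) (K.inv_mem hgK)
          rwa [show r⁻¹ * (g * r⁻¹)⁻¹ * r⁻¹⁻¹ = (r⁻¹ * r) * g⁻¹ * r by group, inv_mul_cancel,
            one_mul, ← hrinv] at this }
  refine ⟨r, hr, fun g hg => ?_⟩
  have hOS : orthogonalGroupOf F (QMinusEven a) ≤ S := by
    refine orthogonalGroupOf_le_of_reflections_of_siegels ?_ ?_
    · intro s m hm hs
      obtain ⟨d, hd, hdm⟩ := exists_smul_norm_one hm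
      obtain ⟨k, hk, hkm⟩ := exists_siegelSubgroup_mulVec hcn hdm
      have hkO := siegelSubgroup_le_orthogonalGroupOf hk
      have hs' : s = k * r * k⁻¹ := gl_ext fun z => by
        rw [gl_mul_mulVec, gl_mul_mulVec, hs, hrz, mulVec_reflectionMap hkO,
          gl_mulVec_inv_mulVec, hkm, reflectionMap_smul hd]
      refine ⟨hs' ▸ Subgroup.mul_mem _ (Subgroup.mul_mem _ hkO hr) (Subgroup.inv_mem _ hkO),
        Or.inr ?_⟩
      rw [hs', mul_assoc, mul_assoc, ← mul_assoc r]
      exact K.mul_mem hk (conj_mem_siegelSubgroup hr (K.inv_mem hk))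
    · intro s p w hp hw hs
      have hsK := siegel_mem_siegelSubgroup hp hw hs
      exact ⟨siegelSubgroup_le_orthogonalGroupOf hsK, Or.inl hsK⟩
  exact (hOS hg).2

theorem mul_self_mem_siegelSubgroup {g : GL (Fin 8) F}
    (hg : g ∈ orthogonalGroupOf F (QMinusEven a)) : g * g ∈ siegelSubgroup a := by
  obtain ⟨r, hr, h⟩ := exists_mem_siegelSubgroup_or_mul_mem a
  rcases h g hg with hgK | hgK
  · exact Subgroup.mul_mem _ hgK hgK
  · rcases h (g * g) (Subgroup.mul_mem _ hg hg) with hggK | hggK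
    · exact hggK
    · have h1 := Subgroup.mul_mem _ (Subgroup.inv_mem _ hgK)
        (conj_mem_siegelSubgroup (Subgroup.inv_mem _ hg) hggK)
      rw [show (g * r⁻¹)⁻¹ * (g⁻¹ * (g * g * r⁻¹) * g⁻¹⁻¹) = r * g⁻¹ * g * r⁻¹ * g by group,
        inv_mul_cancel_right, mul_inv_cancel, one_mul] at h1
      exact Subgroup.mul_mem _ h1 h1

theorem commutator_orthogonalGroupOf_le (a : F) :
    ⁅orthogonalGroupOf F (QMinusEven a), orthogonalGroupOf F (QMinusEven a)⁆ ≤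
      siegelSubgroup a := by
  obtain ⟨r, hr, h⟩ := exists_mem_siegelSubgroup_or_mul_mem a
  let K := siegelSubgroup a
  refine Subgroup.commutator_le.2 fun g hg k hk => ?_
  rw [commutatorElement_def]
  rcases h g hg with hgK | hgK
  · have := K.mul_mem hgK (conj_mem_siegelSubgroup hk (K.inv_mem hgK))
    simpa only [mul_assoc] using this
  rcases h k hk with hkK | hkK
  · exact K.mul_mem (conj_mem_siegelSubgroup hg hkK) (K.inv_mem hkK)
  have h1 := K.mul_mem (K.mul_mem hgK
    (conj_mem_siegelSubgroup hr (K.mul_mem hkK (K.inv_mem hgK)))) (K.inv_mem hkK)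
  rwa [show g * r⁻¹ * (r * (k * r⁻¹ * (g * r⁻¹)⁻¹) * r⁻¹) * (k * r⁻¹)⁻¹ = g * k * g⁻¹ * k⁻¹ by
    group] at h1

end Commutator

section Vectors

variable {F : Type*} [Field F]

/-- The singular vector `c (e₇ + e₈)`. -/
def dVec₀ (c : F) : Fin 8 → F := ![0, 0, 0, 0, 0, 0, c, c]

/-- The singular vector `c (e₆ + e₈)`. -/
def dVec₁ (c : F) : Fin 8 → F := ![0, 0, 0, 0, 0, c, 0, c]

/-- The singular vector `c (e₆ + e₇)`. -/
def dVec₂ (c : F) : Fin 8 → F := ![0, 0, 0, 0, 0, c, c, 0]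

/-- The singular vector `a e₅ + e₆`. -/
def sVec₀ (a : F) : Fin 8 → F := ![0, 0, 0, 0, a, 1, 0, 0]

/-- The singular vector `a (e₁ + e₅) + e₇`. -/
def sVec₁ (a : F) : Fin 8 → F := ![a, 0, 0, 0, a, 0, 1, 0]

/-- The singular vector `a e₁ + e₈`. -/
def sVec₂ (a : F) : Fin 8 → F := ![a, 0, 0, 0, 0, 0, 0, 1]

/-- The vector `(a + 1)⁻² (e₃ + e₄) + a⁻² (a e₅ + e₆)`. -/
def wVec (a : F) : Fin 8 → F :=
  ![0, 0, ((a + 1) ^ 2)⁻¹, ((a + 1) ^ 2)⁻¹, a⁻¹, (a ^ 2)⁻¹, 0, 0]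

/-- The nonsingular vector `a⁻¹ e₁ + e₂ + e₆ + a⁻² (e₇ + e₈)`. -/
def nVec (a : F) : Fin 8 → F := ![a⁻¹, 1, 0, 0, 0, 1, (a ^ 2)⁻¹, (a ^ 2)⁻¹]

/-- The vector `c (e₃ + e₄)`. -/
def eVec₀ (c : F) : Fin 8 → F := ![0, 0, c, c, 0, 0, 0, 0]

/-- The vector `c (e₂ + e₄)`. -/
def eVec₁ (c : F) : Fin 8 → F := ![0, c, 0, c, 0, 0, 0, 0]

theorem smul_dVec₀ (c : F) : c • dVec₀ (1 : F) = dVec₀ c := by simp [dVec₀]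

theorem smul_dVec₁ (c : F) : c • dVec₁ (1 : F) = dVec₁ c := by simp [dVec₁]

/-- The action of the order three generator on coordinates. -/
def rotate (v : Fin 8 → F) : Fin 8 → F := ![v 4, v 3, v 1, v 2, v 0 + v 4, v 7, v 5, v 6]

theorem yMinusEven_mulVec (v : Fin 8 → F) : yMinusEven F *ᵥ v = rotate v := by
  ext i
  fin_cases i <;> simp [yMinusEven, rotate, Matrix.mulVec, dotProduct, Fin.sum_univ_succ]

theorem rotate_dVec₀ (c : F) : rotate (dVec₀ c) = dVec₁ c := by simp [rotate, dVec₀, dVec₁]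

theorem rotate_dVec₁ (c : F) : rotate (dVec₁ c) = dVec₂ c := by simp [rotate, dVec₁, dVec₂]

theorem rotate_dVec₂ (c : F) : rotate (dVec₂ c) = dVec₀ c := by simp [rotate, dVec₂, dVec₀]

theorem rotate_sVec₀ (a : F) : rotate (sVec₀ a) = sVec₁ a := by simp [rotate, sVec₀, sVec₁]

theorem rotate_sVec₂ (a : F) : rotate (sVec₂ a) = sVec₀ a := by simp [rotate, sVec₂, sVec₀]

theorem rotate_eVec₀ (c : F) : rotate (eVec₀ c) = eVec₁ c := by simp [rotate, eVec₀, eVec₁]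

theorem wVec_eq {a : F} (ha : a ≠ 0) :
    wVec a = eVec₀ ((a + 1) ^ 2)⁻¹ + (a ^ 2)⁻¹ • sVec₀ a := by
  ext i
  fin_cases i <;> simp [wVec, eVec₀, sVec₀]
  field_simp

theorem siegel_wVec_sVec₀ (a : F) : siegel a (dVec₀ 1) (wVec a) (sVec₀ a) = sVec₀ a := by
  ext i
  fin_cases i <;> simp [siegel_apply, polarForm, QMinusEven, dVec₀, sVec₀, wVec]

theorem siegel_wVec_dVec₁ (a c : F) :
    siegel a (dVec₀ 1) (wVec a) (dVec₁ c) = dVec₀ (((a + 1) ^ 2)⁻¹ * c) + dVec₁ c := by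
  ext i
  fin_cases i <;> simp [siegel_apply, polarForm, QMinusEven, dVec₀, dVec₁, wVec] <;> ring

theorem siegel_dVec₁_dVec₀ (a c c' : F) :
    siegel a (sVec₁ a) (dVec₁ c) (dVec₀ c') = dVec₀ c' := by
  ext i
  fin_cases i <;> simp [siegel_apply, polarForm, QMinusEven, dVec₀, dVec₁, sVec₁]

theorem siegel_eVec₀_sVec₁ (a c : F) :
    siegel a (dVec₀ 1) (eVec₀ c) (sVec₁ a) = c • dVec₀ 1 + sVec₁ a := by
  ext i
  fin_cases i <;> simp [siegel_apply, polarForm, QMinusEven, dVec₀, eVec₀, sVec₁]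
  ring

theorem siegel_eVec₀_dVec₂ (a c c' : F) :
    siegel a (dVec₀ 1) (eVec₀ c) (dVec₂ c') = dVec₀ (c * c') + dVec₂ c' := by
  ext i
  fin_cases i <;> simp [siegel_apply, polarForm, QMinusEven, dVec₀, eVec₀, dVec₂] <;> ring

theorem siegel_eVec₁_dVec₀ (a c c' : F) :
    siegel a (dVec₁ 1) (eVec₁ c + (c * (a ^ 2)⁻¹) • sVec₁ a) (dVec₀ c') =
      dVec₁ (c * c') + dVec₀ c' := by
  ext i
  fin_cases i <;> simp [siegel_apply, polarForm, QMinusEven, dVec₀, dVec₁, eVec₁, sVec₁] <;> ring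

theorem dVec₁_add_dVec₁ (c c' : F) : dVec₁ c + dVec₁ c' = dVec₁ (c + c') := by
  simp [dVec₁]

variable [CharP F 2]

theorem rotate_sVec₁ (a : F) : rotate (sVec₁ a) = sVec₂ a := by
  simp [rotate, sVec₁, sVec₂, CharTwo.add_self_eq_zero]

theorem QMinusEven_dVec₀ (a c : F) : QMinusEven a (dVec₀ c) = 0 := by
  simp [QMinusEven, dVec₀, CharTwo.add_self_eq_zero]

theorem QMinusEven_dVec₁ (a c : F) : QMinusEven a (dVec₁ c) = 0 := by
  simp [QMinusEven, dVec₁, CharTwo.add_self_eq_zero]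

theorem QMinusEven_dVec₂ (a c : F) : QMinusEven a (dVec₂ c) = 0 := by
  simp [QMinusEven, dVec₂, CharTwo.add_self_eq_zero]

theorem QMinusEven_sVec₀ (a : F) : QMinusEven a (sVec₀ a) = 0 := by
  simp [QMinusEven, sVec₀, CharTwo.add_self_eq_zero]

theorem QMinusEven_sVec₁ (a : F) : QMinusEven a (sVec₁ a) = 0 := by
  simp [QMinusEven, sVec₁]
  linear_combination 2 * a ^ 2 * (two_eq_zero_of_charTwo : (2 : F) = 0)

theorem siegel_dVec₁_sVec₀ (a c : F) :
    siegel a (sVec₁ a) (dVec₁ c) (sVec₀ a) = sVec₀ a + dVec₁ (a ^ 2 * c) := by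
  rw [siegel_apply, QMinusEven_dVec₁]
  ext i
  fin_cases i <;> simp [polarForm, dVec₁, sVec₀, sVec₁, ← sq]

theorem siegel_eVec₁_sVec₀ {a : F} (ha : a ≠ 0) (c : F) :
    siegel a (dVec₁ 1) (eVec₁ c + (c * (a ^ 2)⁻¹) • sVec₁ a) (sVec₀ a) = sVec₀ a := by
  have h2 : (2 : F) = 0 := two_eq_zero_of_charTwo
  ext i
  fin_cases i <;> simp [siegel_apply, polarForm, QMinusEven, dVec₁, eVec₁, sVec₀, sVec₁] <;>
    field_simp <;> linear_combination c * h2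

theorem dVec₀_add_dVec₁ (c : F) : dVec₀ c + dVec₁ c = dVec₂ c := by
  ext i
  fin_cases i <;> simp [dVec₀, dVec₁, dVec₂, CharTwo.add_self_eq_zero]

theorem QMinusEven_dVec₀_add_dVec₂ (a c c' : F) : QMinusEven a (dVec₀ c + dVec₂ c') = 0 := by
  rw [QMinusEven_add, QMinusEven_dVec₀, QMinusEven_dVec₂]
  simp [polarForm, dVec₀, dVec₂]

theorem smul_dVec₀_add_dVec₂ {a : F} (ha : a ≠ 0) (ha' : a + 1 ≠ 0) :
    ((a + 1) ^ 2)⁻¹ • (dVec₀ (a ^ 2)⁻¹ + dVec₂ ((a + 1) ^ 2 * (a ^ 2)⁻¹)) =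
      dVec₁ (a ^ 2)⁻¹ + ((a ^ 2)⁻¹ + ((a + 1) ^ 2)⁻¹ * (a ^ 2)⁻¹) • dVec₀ (1 : F) := by
  have h2 : (2 : F) = 0 := two_eq_zero_of_charTwo
  ext i
  fin_cases i <;> simp [dVec₀, dVec₁, dVec₂] <;> field_simp
  · ring
  · linear_combination (-(a + 1) ^ 2) * h2

end Vectors

section SubfieldClosure

variable {F : Type*} [Field F]

/-- A subset of a finite field of characteristic two that contains `1`, is closed under addition and
stable under multiplication by `c⁴`, is everything if `c` generates the field. -/
theorem forall_of_stable_mul_pow_four [Finite F] [CharP F 2] {c : F}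
    (hc : Subfield.closure {c} = ⊤) {P : F → Prop} (h0 : P 0) (h1 : P 1)
    (hadd : ∀ x y, P x → P y → P (x + y)) (hmul : ∀ x, P x → P (c ^ 4 * x)) (x : F) : P x := by
  let S : Subring F :=
    { carrier := {z | ∀ x, P x → P (z * x)}
      one_mem' := fun x hx => by rwa [one_mul]
      mul_mem' := fun hz hz' x hx => by rw [mul_assoc]; exact hz _ (hz' _ hx)
      zero_mem' := fun x _ => by rwa [zero_mul]
      add_mem' := fun hz hz' x hx => by rw [add_mul]; exact hadd _ _ (hz _ hx) (hz' _ hx)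
      neg_mem' := fun hz x hx => by rw [CharTwo.neg_eq]; exact hz _ hx }
  have := Fintype.ofFinite F
  let K : Subfield F :=
    { S with
      inv_mem' := fun z hz => by
        rcases eq_or_ne z 0 with rfl | hz0
        · rwa [_root_.inv_zero]
        · have h : z ^ (Fintype.card F - 2) * z = 1 := by
            rw [← pow_succ, ← FiniteField.pow_card_sub_one_eq_one z hz0]
            congr 1
            have := Fintype.one_lt_card (α := F)
            omega
          rw [← eq_inv_of_mul_eq_one_left h]
          exact S.pow_mem hz _ }
  have hsq : ∀ z : F, z ^ 2 ∈ K → z ∈ K := fun z hz => by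
    obtain ⟨d, hd⟩ := exists_sq_eq_of_charTwo (⟨z ^ 2, hz⟩ : K)
    have : (d : F) ^ 2 = z ^ 2 := congrArg Subtype.val hd
    rw [← CharTwo.sq_inj.1 this]
    exact d.2
  have hcK : c ∈ K := hsq _ (hsq _ (by rw [← pow_mul]; exact hmul))
  have hK : K = ⊤ := top_le_iff.1 (hc ▸ Subfield.closure_le.2 (by simpa using hcK))
  have hx : x ∈ K := hK ▸ Subfield.mem_top x
  simpa using hx 1 h1

end SubfieldClosure

section Spread

variable {F : Type*} [Field F] {a : F} {H : Subgroup (GL (Fin 8) F)}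

theorem HasSiegel.swap {p w : Fin 8 → F} {c : F} (h : HasSiegel a H p (c • w))
    (hw : QMinusEven a w = 0) : HasSiegel a H w (c • p) := by
  rcases eq_or_ne c 0 with rfl | hc
  · rw [zero_smul]
    exact HasSiegel.zero hw
  · exact (h.symm (by rw [QMinusEven_smul, hw, mul_zero])).of_smul_left hc

theorem HasSiegel.smul_left {p w : Fin 8 → F} {c : F} (hc : c ≠ 0) (h : HasSiegel a H p (c • w)) :
    HasSiegel a H (c • p) w := by
  have h' : HasSiegel a H (c⁻¹ • c • p) (c • w) := by rwa [inv_smul_smul₀ hc]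
  simpa only [inv_smul_smul₀ hc] using h'.of_smul_left (inv_ne_zero hc)

variable [CharP F 2]

theorem HasSiegel.conj_eq (hH : H ≤ orthogonalGroupOf F (QMinusEven a))
    {p w p' w' p₁ w₁ : Fin 8 → F}
    (h : HasSiegel a H p w) (h' : HasSiegel a H p' w') (hp : siegel a p' w' p = p₁)
    (hw : siegel a p' w' w = w₁) : HasSiegel a H p₁ w₁ :=
  hp ▸ hw ▸ h.conj_siegel hH h'

/-- The long root subgroups attached to `a e₅ + e₆` and the vectors `c (e₇ + e₈)`,
`c (e₆ + e₈)`. -/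
theorem hasSiegel_sVec₀ [Finite F] (ha : a ≠ 0) (ha' : a + 1 ≠ 0) (hgen : Subfield.closure {a} = ⊤)
    (hH : H ≤ orthogonalGroupOf F (QMinusEven a))
    (hy : ∀ {p w}, HasSiegel a H p w → HasSiegel a H (rotate p) (rotate w))
    (ht : HasSiegel a H (dVec₀ 1) (wVec a))
    (hT : HasSiegel a H (sVec₀ a) (dVec₁ ((a + 1) ^ 2 * (a ^ 2)⁻¹))) :
    (∀ c, HasSiegel a H (sVec₀ a) (dVec₀ c)) ∧ ∀ c, HasSiegel a H (sVec₀ a) (dVec₁ c) := by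
  have h2 : (2 : F) = 0 := two_eq_zero_of_charTwo
  have h10 : ∀ c, HasSiegel a H (sVec₀ a) (dVec₁ c) →
      HasSiegel a H (sVec₀ a) (dVec₀ (((a + 1) ^ 2)⁻¹ * c)) := fun c h =>
    (h.conj_eq hH ht (siegel_wVec_sVec₀ a) (siegel_wVec_dVec₁ a c)).of_add h
  have hs0 : HasSiegel a H (sVec₀ a) (dVec₀ (a ^ 2)⁻¹) := by
    have h := h10 _ hT
    rwa [inv_mul_cancel_left₀ (pow_ne_zero 2 ha')] at h
  have hs1 : HasSiegel a H (sVec₁ a) (dVec₁ (a ^ 2)⁻¹) := by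
    simpa only [rotate_sVec₀, rotate_dVec₀] using hy hs0
  have he0 : HasSiegel a H (dVec₀ 1) (eVec₀ ((a + 1) ^ 2)⁻¹) := by
    rw [wVec_eq ha] at ht
    rw [← smul_dVec₀] at hs0
    exact ht.of_add (hs0.swap (QMinusEven_dVec₀ a 1))
  have he1 : HasSiegel a H (dVec₁ 1) (eVec₁ ((a + 1) ^ 2)⁻¹) := by
    simpa only [rotate_eVec₀, rotate_dVec₀] using hy he0
  have hd : HasSiegel a H (dVec₀ 1) (dVec₁ (a ^ 2)⁻¹) := by
    have h := hs0.conj_eq hH hs1 (siegel_dVec₁_sVec₀ a _) (siegel_dVec₁_dVec₀ a _ _)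
    rw [← smul_dVec₀] at h hs0
    have h' := (h.swap (QMinusEven_dVec₀ a 1)).add (hs0.swap (QMinusEven_dVec₀ a 1))
    rw [smul_add, add_comm, ← add_assoc, add_self_charTwo, zero_add, ← smul_dVec₁ (_ * _),
      smul_smul, mul_inv_cancel₀ (pow_ne_zero 2 ha), mul_one, smul_dVec₁] at h'
    exact h'
  have hs12 : HasSiegel a H (sVec₁ a) (dVec₂ ((a + 1) ^ 2 * (a ^ 2)⁻¹)) := by
    simpa only [rotate_sVec₀, rotate_dVec₁] using hy hT
  have hs10 : HasSiegel a H (sVec₁ a) (dVec₀ (a ^ 2)⁻¹) := by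
    have h := hs12.conj_eq hH he0 (siegel_eVec₀_sVec₁ a _) (siegel_eVec₀_dVec₂ a _ _)
    rw [inv_mul_cancel_left₀ (pow_ne_zero 2 ha')] at h
    refine ((h.of_add_left ?_ ?_ (QMinusEven_sVec₁ a)).of_add hs12)
    · refine HasSiegel.smul_left (inv_ne_zero (pow_ne_zero 2 ha')) ?_
      rw [smul_dVec₀_add_dVec₂ ha ha']
      exact hd.add_smul_self _
    · rw [QMinusEven_dVec₀_add_dVec₂, zero_smul]
      exact HasSiegel.zero (by rw [QMinusEven_smul, QMinusEven_dVec₀, mul_zero])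
  have hs01 : HasSiegel a H (sVec₀ a) (dVec₁ (a ^ 2)⁻¹) := by
    have h := hy (hy hs10)
    simp only [rotate_sVec₁, rotate_sVec₂, rotate_dVec₀, rotate_dVec₁] at h
    rw [← dVec₀_add_dVec₁, add_comm] at h
    exact h.of_add hs0
  have hone : HasSiegel a H (sVec₀ a) (dVec₁ 1) := by
    have h := hT.add hs01
    rwa [dVec₁_add_dVec₁, show (a + 1) ^ 2 * (a ^ 2)⁻¹ + (a ^ 2)⁻¹ = 1 by
      field_simp
      linear_combination (a + 1) * h2] at h
  have h01 : ∀ c, HasSiegel a H (sVec₀ a) (dVec₀ c) →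
      HasSiegel a H (sVec₀ a) (dVec₁ (((a + 1) ^ 2)⁻¹ * c)) := fun c h => by
    have h' := hy (h10 _ hs01)
    rw [rotate_sVec₀, rotate_dVec₀, ← smul_dVec₁] at h'
    exact (h.conj_eq hH (he1.add (h'.swap (QMinusEven_dVec₁ a 1))) (siegel_eVec₁_sVec₀ ha _)
      (siegel_eVec₁_dVec₀ a _ c)).of_add h
  have hall : ∀ c, HasSiegel a H (sVec₀ a) (dVec₁ c) := by
    refine forall_of_stable_mul_pow_four (c := (a + 1)⁻¹) ?_ ?_ hone ?_ ?_
    · rw [eq_top_iff, ← hgen, Subfield.closure_le, Set.singleton_subset_iff]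
      have h := Subfield.inv_mem _ (Subfield.subset_closure (s := {(a + 1)⁻¹}) rfl)
      rw [inv_inv] at h
      simpa using Subfield.sub_mem _ h (Subfield.one_mem _)
    · rw [← smul_dVec₁, zero_smul]
      exact HasSiegel.zero (QMinusEven_sVec₀ a)
    · intro c c' h h'
      simpa only [dVec₁_add_dVec₁] using h.add h'
    · intro c h
      rw [show (a + 1)⁻¹ ^ 4 * c = ((a + 1) ^ 2)⁻¹ * (((a + 1) ^ 2)⁻¹ * c) by field_simp]
      exact h01 _ (h10 _ h)
  refine ⟨fun c => ?_, hall⟩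
  rw [← inv_mul_cancel_left₀ (pow_ne_zero 2 ha') c]
  exact h10 _ (hall _)

end Spread

section Stabilizer

variable {F : Type*} [Field F] {a : F} {H : Subgroup (GL (Fin 8) F)}

/-- The vector `c (e₂ + e₃ + e₄)`. -/
def gVec (c : F) : Fin 8 → F := ![0, c, c, c, 0, 0, 0, 0]

theorem rotate_gVec (c : F) : rotate (gVec c) = gVec c := by simp [rotate, gVec]

theorem smul_gVec (c : F) : c • gVec (1 : F) = gVec c := by simp [gVec]

theorem siegel_nVec_dVec₀ (a c : F) : siegel a (sVec₀ a) (nVec a) (dVec₀ c) = dVec₀ c := by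
  ext i
  fin_cases i <;> simp [siegel_apply, polarForm, dVec₀, nVec, sVec₀]

theorem siegel_nVec_single (a c : F) :
    siegel a (sVec₀ a) (nVec a) (Pi.single 0 c) =
      Pi.single 0 c + (a * c) • nVec a + (QMinusEven a (nVec a) * (a * c)) • sVec₀ a := by
  rw [siegel_apply]
  congr 2
  · simp [polarForm, sVec₀, mul_comm]
  · simp [polarForm, sVec₀, nVec, mul_comm]

theorem siegel_single_dVec₀ (a c : F) :
    siegel a (dVec₁ 1) (Pi.single 2 c) (dVec₀ 1) = dVec₀ 1 + c • dVec₁ 1 := by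
  ext i
  fin_cases i <;> simp [siegel_apply, polarForm, dVec₀, dVec₁]

theorem eVec₀_add_single (c : F) : eVec₀ c + Pi.single 1 c = gVec c := by
  ext i
  fin_cases i <;> simp [eVec₀, gVec]

theorem rotate_single_one (c : F) : rotate (Pi.single 1 c) = Pi.single 2 c := by
  ext i
  fin_cases i <;> simp [rotate]

variable [CharP F 2]

theorem siegel_single_gVec (a c c' : F) :
    siegel a (dVec₁ 1) (Pi.single 2 c) (gVec c') = gVec c' := by
  ext i
  fin_cases i <;>
    simp [siegel_apply, polarForm, gVec, dVec₁, CharTwo.add_self_eq_zero]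

theorem single_five_eq (a c : F) :
    (Pi.single 5 c : Fin 8 → F) = c • sVec₀ a + c • sVec₁ a + c • sVec₂ a + dVec₀ c := by
  have h2 : (2 : F) = 0 := two_eq_zero_of_charTwo
  ext i
  fin_cases i <;> simp [sVec₀, sVec₁, sVec₂, dVec₀] <;> grind

theorem single_seven_eq (c : F) :
    (Pi.single 7 c : Fin 8 → F) = dVec₁ c + Pi.single 5 c := by
  ext i
  fin_cases i <;> simp [dVec₁, CharTwo.add_self_eq_zero]

theorem single_six_eq (c : F) :
    (Pi.single 6 c : Fin 8 → F) = dVec₀ c + Pi.single 7 c := by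
  ext i
  fin_cases i <;> simp [dVec₀, CharTwo.add_self_eq_zero]

theorem single_four_eq {a : F} (ha : a ≠ 0) (c : F) :
    (Pi.single 4 c : Fin 8 → F) = (c * a⁻¹) • sVec₀ a + Pi.single 5 (c * a⁻¹) := by
  ext i
  fin_cases i <;> simp [sVec₀, CharTwo.add_self_eq_zero, ha]

theorem single_zero_eq {a : F} (ha : a ≠ 0) (c : F) :
    (Pi.single 0 c : Fin 8 → F) = (c * a⁻¹) • sVec₂ a + Pi.single 7 (c * a⁻¹) := by
  ext i
  fin_cases i <;> simp [sVec₂, CharTwo.add_self_eq_zero, ha]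

theorem single_one_eq (a c d : F) :
    Pi.single 0 d + (Pi.single 0 d + c • nVec a + (QMinusEven a (nVec a) * c) • sVec₀ a +
      (QMinusEven a (nVec a) * c) • sVec₀ a) +
      (Pi.single 0 (c * a⁻¹) + (Pi.single 5 c + dVec₀ (c * (a ^ 2)⁻¹))) =
    (Pi.single 1 c : Fin 8 → F) := by
  rw [add_assoc _ (_ • sVec₀ a), add_self_charTwo, add_zero,
    ← add_assoc (Pi.single 0 d : Fin 8 → F), add_self_charTwo, zero_add]
  ext i
  simp only [Pi.add_apply, Pi.smul_apply, smul_eq_mul]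
  fin_cases i <;> simp [nVec, dVec₀, CharTwo.add_self_eq_zero]

/-- The full unipotent radical of the stabilizer of the singular line through `e₇ + e₈`. -/
theorem hasSiegel_dVec₀ [Finite F] (ha : a ≠ 0) (ha' : a + 1 ≠ 0) (hgen : Subfield.closure {a} = ⊤)
    (hH : H ≤ orthogonalGroupOf F (QMinusEven a))
    (hy : ∀ {p w}, HasSiegel a H p w → HasSiegel a H (rotate p) (rotate w))
    (ht : HasSiegel a H (dVec₀ 1) (wVec a)) (hv : HasSiegel a H (sVec₀ a) (nVec a))
    (hT : HasSiegel a H (sVec₀ a) (dVec₁ ((a + 1) ^ 2 * (a ^ 2)⁻¹))) {w : Fin 8 → F}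
    (hw : polarForm (dVec₀ 1) w = 0) : HasSiegel a H (dVec₀ 1) w := by
  have h2 : (2 : F) = 0 := two_eq_zero_of_charTwo
  obtain ⟨h00, h01⟩ := hasSiegel_sVec₀ ha ha' hgen hH hy ht hT
  have h02 : ∀ c, HasSiegel a H (sVec₀ a) (dVec₂ c) := fun c => by
    rw [← dVec₀_add_dVec₁]
    exact (h00 c).add (h01 c)
  have hQd := QMinusEven_dVec₀ a (1 : F)
  have hs0 : ∀ c : F, HasSiegel a H (dVec₀ 1) (c • sVec₀ a) := fun c =>
    HasSiegel.swap (by rw [smul_dVec₀]; exact h00 c) hQd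
  have hs1 : ∀ c : F, HasSiegel a H (dVec₀ 1) (c • sVec₁ a) := fun c =>
    HasSiegel.swap (by
      rw [smul_dVec₀]
      simpa only [rotate_sVec₀, rotate_dVec₂] using hy (h02 c)) hQd
  have hs2 : ∀ c : F, HasSiegel a H (dVec₀ 1) (c • sVec₂ a) := fun c =>
    HasSiegel.swap (by
      rw [smul_dVec₀]
      simpa only [rotate_sVec₀, rotate_sVec₁, rotate_dVec₁, rotate_dVec₂] using hy (hy (h01 c))) hQd
  have hd0 : ∀ c, HasSiegel a H (dVec₀ 1) (dVec₀ c) := fun c => by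
    rw [← smul_dVec₀ c]
    exact HasSiegel.smul_self hQd c
  have hd1 : ∀ c, HasSiegel a H (dVec₀ 1) (dVec₁ c) := fun c => by
    have hs : HasSiegel a H (sVec₁ a) (dVec₁ ((a ^ 2)⁻¹ * c)) := by
      simpa only [rotate_sVec₀, rotate_dVec₀] using hy (h00 ((a ^ 2)⁻¹ * c))
    have h := (h00 1).conj_eq hH hs (siegel_dVec₁_sVec₀ a _) (siegel_dVec₁_dVec₀ a _ _)
    rw [mul_inv_cancel_left₀ (pow_ne_zero 2 ha), add_comm] at h
    have h' := h.symm hQd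
    exact h'.of_add ((h00 1).symm hQd)
  have e5 : ∀ c, HasSiegel a H (dVec₀ 1) (Pi.single 5 c) := fun c => by
    rw [single_five_eq a c]
    exact (((hs0 c).add (hs1 c)).add (hs2 c)).add (hd0 c)
  have e7 : ∀ c, HasSiegel a H (dVec₀ 1) (Pi.single 7 c) := fun c => by
    rw [single_seven_eq c]
    exact (hd1 c).add (e5 c)
  have e6 : ∀ c, HasSiegel a H (dVec₀ 1) (Pi.single 6 c) := fun c => by
    rw [single_six_eq c]
    exact (hd0 c).add (e7 c)
  have e4 : ∀ c, HasSiegel a H (dVec₀ 1) (Pi.single 4 c) := fun c => by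
    rw [single_four_eq ha c]
    exact (hs0 _).add (e5 _)
  have e0 : ∀ c, HasSiegel a H (dVec₀ 1) (Pi.single 0 c) := fun c => by
    rw [single_zero_eq ha c]
    exact (hs2 _).add (e7 _)
  have e1 : ∀ c, HasSiegel a H (dVec₀ 1) (Pi.single 1 c) := fun c => by
    have h := (e0 (a⁻¹ * c)).conj_eq hH hv (siegel_nVec_dVec₀ a 1) (siegel_nVec_single a _)
    rw [mul_inv_cancel_left₀ ha] at h
    have h' := ((e0 (a⁻¹ * c)).add (h.add (hs0 (QMinusEven a (nVec a) * c)))).add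
      ((e0 (c * a⁻¹)).add ((e5 c).add (hd0 (c * (a ^ 2)⁻¹))))
    rwa [single_one_eq] at h'
  have e12 : ∀ c, HasSiegel a H (dVec₁ 1) (Pi.single 2 c) := fun c => by
    have h := hy (e1 c)
    rwa [rotate_dVec₀, rotate_single_one] at h
  have he0 : HasSiegel a H (dVec₀ 1) (eVec₀ ((a + 1) ^ 2)⁻¹) := by
    rw [wVec_eq ha] at ht
    exact ht.of_add (hs0 _)
  have hg : HasSiegel a H (dVec₀ 1) (gVec ((a + 1) ^ 2)⁻¹) := by
    rw [← eVec₀_add_single]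
    exact he0.add (e1 _)
  have hg1 : ∀ c, HasSiegel a H (dVec₁ 1) (gVec c) := fun c => by
    rcases eq_or_ne c 0 with rfl | hc
    · rw [← smul_gVec, zero_smul]
      exact HasSiegel.zero (QMinusEven_dVec₁ a 1)
    have h := hg.conj_eq hH (e12 ((a + 1) ^ 2 * c)) (siegel_single_dVec₀ a _)
      (siegel_single_gVec a _ _)
    have h' := h.of_add_left hg (by rw [smul_smul, smul_dVec₁]; exact hd1 _)
      (by rw [smul_dVec₁]; exact QMinusEven_dVec₁ a _)
    have h'' := h'.of_smul_left (mul_ne_zero (pow_ne_zero 2 ha') hc)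
    rw [← smul_gVec, smul_smul, mul_right_comm, mul_inv_cancel₀ (pow_ne_zero 2 ha'), one_mul,
      smul_gVec] at h''
    exact h''
  have hg0 : ∀ c, HasSiegel a H (dVec₀ 1) (gVec c) := fun c => by
    simpa only [rotate_dVec₁, rotate_dVec₂, rotate_gVec] using hy (hy (hg1 c))
  have hw23 : w 3 = w 2 := by
    simp [polarForm, dVec₀] at hw
    linear_combination hw - w 2 * h2
  have h := ((((((hg0 (w 2)).add (e1 (w 2 + w 1))).add (e0 (w 0))).add (e4 (w 4))).add
    (e5 (w 5))).add (e6 (w 6))).add (e7 (w 7))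
  convert h using 1
  ext i
  simp only [Pi.add_apply]
  fin_cases i <;> simp [gVec, hw23]
  linear_combination (- w 2) * h2

end Stabilizer

section OddOrder

open Polynomial

variable {F : Type*} [Field F]

theorem mem_of_mul_mem_of_odd_orderOf {G : Type*} [Group G] {H : Subgroup G} {c r : G}
    (hc : c * c = 1) (hcr : Commute c r) (hr : Odd (orderOf r)) (h : c * r ∈ H) : c ∈ H := by
  have hpow : (c * r) ^ orderOf r = c := by
    obtain ⟨m, hm⟩ := hr
    rw [hcr.mul_pow, pow_orderOf_eq_one, mul_one, hm, pow_succ, pow_mul, pow_two, hc, one_pow,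
      one_mul]
  exact hpow ▸ H.pow_mem h _

/-- The self-reciprocal polynomial `X² + c X + 1`. -/
noncomputable def palindromicQuadratic (c : F) : F[X] := X ^ 2 + C c * X + 1

theorem isCoprime_palindromicQuadratic {c d : F} (h : c ≠ d) :
    IsCoprime (palindromicQuadratic c) (palindromicQuadratic d) := by
  have hd : C (c - d) * C (c - d)⁻¹ = 1 := by
    rw [← C_mul, mul_inv_cancel₀ (sub_ne_zero.2 h), C_1]
  refine ⟨1 - (X + C c) * C (c - d)⁻¹, (X + C c) * C (c - d)⁻¹, ?_⟩
  rw [C_sub] at hd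
  simp only [palindromicQuadratic]
  linear_combination (-X ^ 2 - C c * X) * hd

variable [CharP F 2]

theorem separable_palindromicQuadratic {c : F} (hc : c ≠ 0) :
    (palindromicQuadratic c).Separable := by
  have h2 : (2 : F[X]) = 0 := by exact_mod_cast CharP.cast_eq_zero F[X] 2
  have hc' : C c * C c⁻¹ = 1 := by rw [← C_mul, mul_inv_cancel₀ hc, C_1]
  have hder : derivative (palindromicQuadratic c) = C c := by
    simp only [palindromicQuadratic, derivative_add, derivative_X_pow, derivative_C_mul,
      derivative_X, derivative_one, Nat.cast_ofNat, C_ofNat]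
    linear_combination X * h2
  rw [Polynomial.Separable, hder]
  exact ⟨0, C c⁻¹, by linear_combination hc'⟩

theorem separable_X_add_one_mul_palindromicQuadratic {c : F} (hc : c ≠ 0) :
    ((X + 1) * palindromicQuadratic c).Separable := by
  have h2 : (2 : F[X]) = 0 := by exact_mod_cast CharP.cast_eq_zero F[X] 2
  have hc' : C c * C c⁻¹ = 1 := by rw [← C_mul, mul_inv_cancel₀ hc, C_1]
  refine Separable.mul (by simpa using separable_X_add_C (1 : F))
    (separable_palindromicQuadratic hc)
    ⟨-(X + 1 + C c) * C c⁻¹, C c⁻¹, ?_⟩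
  simp only [palindromicQuadratic]
  linear_combination (-1 : F[X]) * hc' - (1 + X * C c⁻¹) * h2

theorem odd_orderOf_of_aeval_eq_zero [Finite F] {n : ℕ} {g : GL (Fin n) F} {f : F[X]}
    (hf : Squarefree f) (h : aeval g.1 f = 0) : Odd (orderOf g) := by
  have h2 : (2 : Matrix (Fin n) (Fin n) F) = 0 := by
    rw [← map_ofNat (algebraMap F (Matrix (Fin n) (Fin n) F)) 2,
      show (OfNat.ofNat 2 : F) = 0 from two_eq_zero_of_charTwo, map_zero]
  rw [← Nat.not_even_iff_odd]
  rintro ⟨k, hk⟩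
  have hpos := orderOf_pos g
  have hsq : aeval g.1 ((X ^ k - 1) ^ 2 : F[X]) = 0 := by
    have h1 : g.1 ^ (k + k) = 1 := by
      rw [← hk, ← Units.val_pow_eq_pow_val, pow_orderOf_eq_one, Units.val_one]
    have : (g.1 ^ k - 1) ^ 2 = g.1 ^ (k + k) - 1 - 2 * (g.1 ^ k - 1) := by
      rw [pow_add]; noncomm_ring
    simp [this, h1, h2]
  have hdvd : minpoly F g.1 ∣ X ^ k - 1 :=
    ((hf.squarefree_of_dvd (minpoly.dvd F g.1 h)).dvd_pow_iff_dvd two_ne_zero).1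
      (minpoly.dvd F g.1 hsq)
  have h0 : aeval g.1 (X ^ k - 1 : F[X]) = 0 := (minpoly.dvd_iff).1 hdvd
  have hgk : g ^ k = 1 := by
    ext1
    rw [Units.val_pow_eq_pow_val, Units.val_one]
    simpa [sub_eq_zero] using h0
  have := Nat.le_of_dvd (by omega) (orderOf_dvd_of_pow_eq_one hgk)
  omega

end OddOrder

section RootPair

variable {F : Type*} [Field F] {a : F}

theorem siegel_eq_of_singular {p q : Fin 8 → F} (hq : QMinusEven a q = 0) (z : Fin 8 → F) :
    siegel a p q z = z + (polarForm z p • q + polarForm z q • p) := by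
  rw [siegel_apply, hq]; simp [add_assoc]

variable [CharP F 2]

theorem cubic_relation_of_square_zero {A : Type*} [Ring A] [Algebra F A] {N M : A} {κ : F}
    (hN : N * N = 0) (hM : M * M = 0) (hNM : N * M * N = κ • N) (hMN : M * N * M = κ • M) :
    ((1 + N) * (1 + M) + 1) *
      (((1 + N) * (1 + M)) ^ 2 + κ • ((1 + N) * (1 + M)) + 1) = 0 := by
  have h2 : ∀ x : A, x + x = 0 := fun x => by
    rw [← two_smul F x, two_eq_zero_of_charTwo, zero_smul]
  have hNNM : N * (N * M) = 0 := by rw [← mul_assoc, hN, zero_mul]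
  have hMNM : M * (N * M) = κ • M := by rw [← mul_assoc, hMN]
  have hNMM : N * M * M = 0 := by rw [mul_assoc, hM, mul_zero]
  have hNMNM : N * M * (N * M) = κ • (N * M) := by rw [← mul_assoc, hNM, smul_mul_assoc]
  have hNMMN : N * M * (M * N) = 0 := by rw [← mul_assoc, hNMM, zero_mul]
  have hMMN : M * (M * N) = 0 := by rw [← mul_assoc, hM, zero_mul]
  have hNMN : N * (M * N) = κ • N := by rw [← mul_assoc, hNM]
  obtain ⟨D, hD⟩ : ∃ D, D = N + M + N * M := ⟨_, rfl⟩
  have hk : (1 + N) * (1 + M) = 1 + D := by rw [hD]; noncomm_ring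
  have hDD : D * D = N * M + M * N + κ • D := by
    simp only [hD, mul_add, add_mul, hN, hM, hNM, hNNM, hMNM, hNMM, hNMNM, smul_add]
    abel
  have hquad : (1 + D) ^ 2 + κ • (1 + D) + 1 = N * M + M * N + κ • (1 : A) := by
    calc (1 + D) ^ 2 + κ • (1 + D) + 1
        = D * D + κ • D + κ • (1 : A) + (D + D) + (1 + 1) := by
          simp only [pow_two, smul_add, mul_add, add_mul, one_mul, mul_one]; abel
      _ = N * M + M * N + κ • (1 : A) := by
          rw [hDD, h2, h2, add_zero, add_zero, add_assoc (N * M + M * N), h2, add_zero]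
  have hDq : D * (N * M + M * N + κ • (1 : A)) = κ • D + κ • D := by
    simp only [hD, mul_add, add_mul, hNNM, hMNM, hNMNM, hNMMN, hMMN, hNMN, smul_add,
      mul_smul_comm, mul_one]
    abel
  rw [hk, hquad, show 1 + D + 1 = D + (1 + 1) by abel, h2, add_zero, hDq, h2]

theorem odd_orderOf_mul_of_siegel [Finite F] {g h : GL (Fin 8) F} {p q p' q' : Fin 8 → F}
    (hq : QMinusEven a q = 0) (hq' : QMinusEven a q' = 0) (hpq : polarForm p q = 0)
    (hpq' : polarForm p' q' = 0) (hg : ∀ z, g.1 *ᵥ z = siegel a p q z)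
    (hh : ∀ z, h.1 *ᵥ z = siegel a p' q' z)
    (hκ : polarForm p p' * polarForm q q' + polarForm p q' * polarForm q p' ≠ 0) :
    Odd (orderOf (g * h)) := by
  set κ := polarForm p p' * polarForm q q' + polarForm p q' * polarForm q p' with hκ_def
  have h2 : (2 : F) = 0 := two_eq_zero_of_charTwo
  have hN : ∀ z, (g.1 - 1) *ᵥ z = polarForm z p • q + polarForm z q • p := fun z => by
    rw [sub_mulVec, one_mulVec, hg, siegel_eq_of_singular hq, add_sub_cancel_left]
  have hM : ∀ z, (h.1 - 1) *ᵥ z = polarForm z p' • q' + polarForm z q' • p' := fun z => by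
    rw [sub_mulVec, one_mulVec, hh, siegel_eq_of_singular hq', add_sub_cancel_left]
  have key : (((1 + (g.1 - 1)) * (1 + (h.1 - 1)) + 1) * (((1 + (g.1 - 1)) * (1 + (h.1 - 1))) ^ 2 +
      κ • ((1 + (g.1 - 1)) * (1 + (h.1 - 1))) + 1)) = 0 := by
    refine cubic_relation_of_square_zero ?_ ?_ ?_ ?_ <;> refine ext_of_mulVec_single fun i => ?_ <;>
      generalize (Pi.single i 1 : Fin 8 → F) = z <;>
      simp only [← mulVec_mulVec, smul_mulVec, hN, hM, zero_mulVec, polarForm_add_left,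
        polarForm_smul_left, polarForm_self, hpq, hpq', polarForm_comm q p, polarForm_comm q' p',
        polarForm_comm p' p, polarForm_comm p' q, polarForm_comm q' p, polarForm_comm q' q]
    · simp
    · simp
    · rw [hκ_def]
      ext i
      simp only [Pi.add_apply, Pi.smul_apply, smul_eq_mul]
      linear_combination (polarForm z p * polarForm q p' * polarForm q q' * p i +
        polarForm z q * polarForm p p' * polarForm p q' * q i) * h2
    · rw [hκ_def]
      ext i
      simp only [Pi.add_apply, Pi.smul_apply, smul_eq_mul]
      linear_combination (polarForm z p' * polarForm p q' * polarForm q q' * p' i +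
        polarForm z q' * polarForm p p' * polarForm q p' * q' i) * h2
  refine odd_orderOf_of_aeval_eq_zero
    (separable_X_add_one_mul_palindromicQuadratic hκ).squarefree ?_
  simpa [palindromicQuadratic, Algebra.smul_def] using key

end RootPair

section Perturbation

open Polynomial

theorem prod_quadratic_perturb_eq_zero {A : Type*} [CommRing A] {w N c d : A} (h2 : (2 : A) = 0)
    (hN : N * N = 0) (hw : (w ^ 2 + w + 1) * N = 0)
    (hf : (w ^ 2 + w + 1) * (w ^ 2 + c * w + 1) * (w ^ 2 + d * w + 1) = (1 + c) * (1 + d) * N) :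
    ((w + w * N) ^ 2 + (w + w * N) + 1) * ((w + w * N) ^ 2 + c * (w + w * N) + 1) *
      ((w + w * N) ^ 2 + d * (w + w * N) + 1) = 0 := by
  grind

theorem pow_thirty_eq_one_add {A : Type*} [CommRing A] {w b N : A} (h2 : (2 : A) = 0)
    (hb : b ^ 2 + b + 1 = 0) (hw : (w ^ 2 + w + 1) * N = 0)
    (hf : (w ^ 2 + w + 1) * (w ^ 2 + b * w + 1) * (w ^ 2 + w + 1) = (1 + b) * N) :
    w ^ 30 = 1 + N := by
  obtain ⟨h, hh⟩ : ∃ h, h = (w - 1) * (w ^ 2 + (b + 1) * w + 1) *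
    (w ^ 8 - w ^ 7 + w ^ 5 - w ^ 4 + w ^ 3 - w + 1) := ⟨_, rfl⟩
  have h3 : w ^ 3 * N = N := by linear_combination (w - 1) * hw
  have hΦ : w ^ 4 + w ^ 3 + w ^ 2 + w + 1 = (w ^ 2 + b * w + 1) * (w ^ 2 + (b + 1) * w + 1) := by
    linear_combination -w ^ 2 * hb - (b * w ^ 3 + b * w) * h2
  have h15 : w ^ 15 - 1 = (w ^ 2 + w + 1) * (w ^ 2 + b * w + 1) * h := by
    rw [hh]
    linear_combination (w - 1) * (w ^ 2 + w + 1) *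
      (w ^ 8 - w ^ 7 + w ^ 5 - w ^ 4 + w ^ 3 - w + 1) * hΦ
  have hhN : h * N = b * w * N := by
    have e1 : (w ^ 8 - w ^ 7 + w ^ 5 - w ^ 4 + w ^ 3 - w + 1) * N = w * N := by
      linear_combination (w ^ 5 - w ^ 4 + 2 * w ^ 2 - 2 * w + 1) * h3 +
        2 * hw - 3 * w * N * h2
    have e2 : (w ^ 2 + (b + 1) * w + 1) * N = b * w * N := by linear_combination hw
    have e3 : (w - 1) * N = w ^ 2 * N := by linear_combination -hw + w * N * h2
    rw [hh]
    linear_combination (w - 1) * (w ^ 2 + (b + 1) * w + 1) * e1 + w * (w - 1) * e2 +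
      b * w ^ 2 * e3 + b * w * h3
  have hbN : (w ^ 2 + b * w + 1) * N = (b + 1) * (w * N) := by linear_combination hw - w * N * h2
  have hb6 : b ^ 2 * (b + 1) ^ 2 = 1 := by linear_combination (b ^ 2 + b - 1) * hb
  have hsq : w ^ 30 = 1 + (w ^ 15 - 1) ^ 2 := by linear_combination (w ^ 15 - 1) * h2
  rw [hsq, h15]
  linear_combination (w ^ 2 + b * w + 1) * h ^ 2 * hf + (1 + b) * h ^ 2 * hbN +
    (1 + b) ^ 2 * w * (h + b * w) * hhN + (1 + b) ^ 2 * b ^ 2 * h3 + N * hb6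

variable {F : Type*} [Field F]

theorem aeval_eq_zero_of_mk_eq_zero {A : Type*} [Ring A] [Algebra F A] {w : A} {m r : F[X]}
    (hm : aeval w m = 0) (h : Ideal.Quotient.mk (Ideal.span {m}) r = 0) : aeval w r = 0 := by
  obtain ⟨k, rfl⟩ := Ideal.mem_span_singleton.1 (Ideal.Quotient.eq_zero_iff_mem.1 h)
  rw [map_mul, hm, zero_mul]

/-- The product of `X² + X + 1`, `X² + c X + 1` and `X² + d X + 1`. -/
noncomputable def palindromicSextic (c d : F) : F[X] :=
  palindromicQuadratic 1 * palindromicQuadratic c * palindromicQuadratic d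

variable [CharP F 2]

theorem two_eq_zero_polynomial_quotient (I : Ideal F[X]) : (2 : F[X] ⧸ I) = 0 := by
  have h2 : (2 : F[X]) = 0 := by exact_mod_cast CharP.cast_eq_zero F[X] 2
  rw [← map_ofNat (Ideal.Quotient.mk I) 2, show (OfNat.ofNat 2 : F[X]) = 0 from h2, map_zero]

theorem separable_palindromicSextic {c d : F} (hc : c ≠ 0) (hd : d ≠ 0) (hc' : 1 ≠ c)
    (hd' : 1 ≠ d) (hcd : c ≠ d) : (palindromicSextic c d).Separable :=
  ((separable_palindromicQuadratic one_ne_zero).mul (separable_palindromicQuadratic hc)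
    (isCoprime_palindromicQuadratic hc')).mul (separable_palindromicQuadratic hd)
    ((isCoprime_palindromicQuadratic hd').mul_left (isCoprime_palindromicQuadratic hcd))

theorem aeval_palindromicSextic_perturb {A : Type*} [Ring A] [Algebra F A] {w : A} {c d : F}
    (hκ : (1 + c) * (1 + d) ≠ 0)
    (hw : aeval w (palindromicQuadratic 1 * palindromicSextic c d) = 0) :
    aeval (w * (1 + ((1 + c) * (1 + d))⁻¹ • aeval w (palindromicSextic c d)))
      (palindromicSextic c d) = 0 := by
  set κ := (1 + c) * (1 + d) with hκ_def
  set S : F[X] := X + X * (C κ⁻¹ * palindromicSextic c d) with hS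
  have hwS : w * (1 + κ⁻¹ • aeval w (palindromicSextic c d)) = aeval w S := by
    simp [hS, mul_add, Algebra.smul_def]
  rw [hwS, ← aeval_comp]
  refine aeval_eq_zero_of_mk_eq_zero hw ?_
  set I := Ideal.span {palindromicQuadratic 1 * palindromicSextic c d} with hI
  have hfP : Ideal.Quotient.mk I (palindromicQuadratic 1) *
      Ideal.Quotient.mk I (palindromicSextic c d) = 0 := by
    rw [← map_mul, Ideal.Quotient.eq_zero_iff_mem]
    exact Ideal.mem_span_singleton_self _
  have hff : Ideal.Quotient.mk I (palindromicSextic c d) *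
      Ideal.Quotient.mk I (palindromicSextic c d) = 0 := by
    nth_rewrite 1 [palindromicSextic]
    rw [map_mul, map_mul, mul_right_comm, mul_right_comm _ _ (Ideal.Quotient.mk I
      (palindromicSextic c d)), hfP, zero_mul, zero_mul]
  have hCκ : Ideal.Quotient.mk I (C κ) * Ideal.Quotient.mk I (C κ⁻¹) = 1 := by
    rw [← map_mul, ← C_mul, mul_inv_cancel₀ hκ, C_1, map_one]
  have key := prod_quadratic_perturb_eq_zero (A := F[X] ⧸ I) (w := Ideal.Quotient.mk I X)
    (N := Ideal.Quotient.mk I (C κ⁻¹ * palindromicSextic c d)) (c := Ideal.Quotient.mk I (C c))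
    (d := Ideal.Quotient.mk I (C d)) (two_eq_zero_polynomial_quotient I) ?_ ?_ ?_
  · simpa [palindromicSextic, palindromicQuadratic, hS] using key
  · rw [map_mul]; linear_combination Ideal.Quotient.mk I (C κ⁻¹) ^ 2 * hff
  · simp only [palindromicQuadratic, map_add, map_mul, map_pow, map_one, one_mul] at hfP ⊢
    linear_combination Ideal.Quotient.mk I (C κ⁻¹) * hfP
  · rw [hκ_def, C_mul, C_add, C_add, map_mul, map_add, map_add, C_1, map_one] at hCκ
    rw [map_mul, ← mul_assoc, hCκ, one_mul]
    simp [palindromicSextic, palindromicQuadratic]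

theorem pow_thirty_eq_of_aeval {A : Type*} [Ring A] [Algebra F A] {w : A} {b : F}
    (hb : b ^ 2 + b + 1 = 0) (hb' : 1 + b ≠ 0)
    (hw : aeval w (palindromicQuadratic 1 * palindromicSextic b 1) = 0) :
    w ^ 30 = 1 + (1 + b)⁻¹ • aeval w (palindromicSextic b 1) := by
  set I := Ideal.span {palindromicQuadratic 1 * palindromicSextic b 1} with hI
  have hfP : Ideal.Quotient.mk I (palindromicQuadratic 1) *
      Ideal.Quotient.mk I (palindromicSextic b 1) = 0 := by
    rw [← map_mul, Ideal.Quotient.eq_zero_iff_mem]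
    exact Ideal.mem_span_singleton_self _
  have hCb : Ideal.Quotient.mk I (C (1 + b)) * Ideal.Quotient.mk I (C (1 + b)⁻¹) = 1 := by
    rw [← map_mul, ← C_mul, mul_inv_cancel₀ hb', C_1, map_one]
  have key := pow_thirty_eq_one_add (A := F[X] ⧸ I) (w := Ideal.Quotient.mk I X)
    (N := Ideal.Quotient.mk I (C (1 + b)⁻¹ * palindromicSextic b 1))
    (b := Ideal.Quotient.mk I (C b)) (two_eq_zero_polynomial_quotient I) ?_ ?_ ?_
  · have h0 := aeval_eq_zero_of_mk_eq_zero
      (r := X ^ 30 - (1 + C (1 + b)⁻¹ * palindromicSextic b 1)) hw ?_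
    · simpa [sub_eq_zero, Algebra.smul_def] using h0
    · rw [map_sub, map_pow, key, map_add, map_one, sub_self]
  · rw [← map_pow, ← map_add, ← map_one (Ideal.Quotient.mk I), ← map_add, ← C_pow, ← C_add, ← C_1,
      ← C_add, hb, C_0, map_zero]
  · simp only [palindromicQuadratic, map_add, map_mul, map_pow, map_one, one_mul] at hfP ⊢
    linear_combination Ideal.Quotient.mk I (C (1 + b)⁻¹) * hfP
  · rw [C_add, map_add, C_1, map_one] at hCb
    rw [map_mul, ← mul_assoc, hCb, one_mul]
    simp [palindromicSextic, palindromicQuadratic]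

theorem mem_of_mem_of_perturb [Finite F] {n : ℕ} {H : Subgroup (GL (Fin n) F)}
    {w u : GL (Fin n) F} {c d : F} (hc : c ≠ 0) (hd : d ≠ 0) (hc' : 1 ≠ c)
    (hd' : 1 ≠ d) (hcd : c ≠ d) (hκ : (1 + c) * (1 + d) ≠ 0)
    (hw : aeval w.1 (palindromicQuadratic 1 * palindromicSextic c d) = 0)
    (hu : u.1 = 1 + ((1 + c) * (1 + d))⁻¹ • aeval w.1 (palindromicSextic c d))
    (huu : u * u = 1) (hwH : w ∈ H) : u ∈ H := by
  have hcomm : Commute u w := by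
    ext1
    have : Commute (aeval w.1 (palindromicSextic c d)) w.1 := by
      simpa using Commute.map (Commute.all (palindromicSextic c d) X) (aeval w.1)
    rw [Units.val_mul, Units.val_mul, hu]
    exact ((Commute.one_left _).add_left (this.smul_left _))
  refine mem_of_mul_mem_of_odd_orderOf (r := w * u) huu ?_ ?_ ?_
  · exact hcomm.mul_right (Commute.refl u)
  · refine odd_orderOf_of_aeval_eq_zero
      (separable_palindromicSextic hc hd hc' hd' hcd).squarefree ?_
    rw [Units.val_mul, hu]
    exact aeval_palindromicSextic_perturb hκ hw
  · rwa [← mul_assoc, hcomm.eq, mul_assoc, huu, mul_one]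

end Perturbation

section Perturbed

variable {F : Type*} [Field F]

/-- The matrix `xy + (xy)⁻¹ + c`, where `b` stands for `a + 1`. -/
def traceMatrix (a b c : F) : Matrix (Fin 8) (Fin 8) F :=
  !![b ^ 2 + c, 0, 0, 1 / a, 0, a, 0, 0;
     0, c, a ^ 2 / b ^ 2, 1 / b ^ 2, a, 0, 0, 0;
     0, a ^ 2 / b ^ 2, c, a ^ 2 / b ^ 2, 0, 0, 0, 0;
     a, 1 / b ^ 2, a ^ 2 / b ^ 2, c, 0, 0, 0, 0;
     0, 1 / a, 0, 1 / a, b ^ 2 + c, 0, 0, a;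
     1 / a, 0, 0, b ^ 2 / a ^ 2, 0, c, a ^ 2 / b ^ 2, 1 / b ^ 2;
     0, 0, 0, 0, 0, a ^ 2 / b ^ 2, c, a ^ 2 / b ^ 2;
     1 / a, b ^ 2 / a ^ 2, 0, 0, 1 / a, 1 / b ^ 2, a ^ 2 / b ^ 2, c]

/-- The product of `xy + (xy)⁻¹ + b⁻²` and `xy + (xy)⁻¹ + b² + b⁻²`. -/
def traceProductMatrix (a b : F) : Matrix (Fin 8) (Fin 8) F :=
  !![a ^ 4 / b ^ 4, 1 / (a * b ^ 2), a / b ^ 2, b ^ 2 / a, 0, 0, a ^ 3 / b ^ 2, a / b ^ 2;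
     a / b ^ 2, a ^ 4 / b ^ 4, a ^ 6 / b ^ 4, a ^ 4 / b ^ 4, 0, 0, 0, a ^ 2;
     a ^ 3 / b ^ 2, a ^ 6 / b ^ 4, a ^ 4 / b ^ 4, a ^ 6 / b ^ 4, a ^ 3 / b ^ 2, 0, 0, 0;
     0, 1 / b ^ 4, a ^ 6 / b ^ 4, a ^ 4 / b ^ 4, a / b ^ 2, a ^ 2, 0, 0;
     0, a ^ 3 / b ^ 2, 0, 1 / (a * b ^ 2), a ^ 4 / b ^ 4, a / b ^ 2, a ^ 3 / b ^ 2, 0;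
     a ^ 3 / b ^ 2, 0, 1, a ^ 2, 1 / (a * b ^ 2), a ^ 4 / b ^ 4, a ^ 6 / b ^ 4, 1 / b ^ 4;
     0, 1, 0, 1, a / b ^ 2, a ^ 6 / b ^ 4, a ^ 4 / b ^ 4, a ^ 6 / b ^ 4;
     1 / (a * b ^ 2), a ^ 2, 1, 0, b ^ 2 / a, a ^ 4 / b ^ 4, a ^ 6 / b ^ 4, a ^ 4 / b ^ 4]

/-- The first of two singular vectors spanning the totally singular plane fixed by a root element
which is a polynomial in `xy`. -/
def uVec₀ (a : F) : Fin 8 → F :=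
  ![1, 0, a ^ 3 * (a + 1) ^ 2, a * (a + 1) ^ 4, (a ^ 2 + a + 1) ^ 2, (a ^ 2 + a + 1) ^ 2 / a,
    a ^ 5, (a ^ 3 + a + 1) ^ 2 / a]

/-- The second of two singular vectors spanning the totally singular plane fixed by a root element
which is a polynomial in `xy`. -/
def uVec₁ (a : F) : Fin 8 → F :=
  ![0, 1, a ^ 4, (a ^ 2 + a + 1) ^ 2, a ^ 3, (a ^ 2 + a + 1) ^ 2 / a ^ 2, (a ^ 2 + a + 1) ^ 2,
    (a ^ 2 + a + 1) ^ 2]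

theorem xMinusEven_mulVec (a : F) (v : Fin 8 → F) :
    xMinusEven F a *ᵥ v =
      ![a⁻¹ * v 1, a * v 0,
        a ^ 2 * ((a + 1) ^ 2)⁻¹ * v 2 + ((a + 1) ^ 2)⁻¹ * v 3,
        ((a + 1) ^ 2)⁻¹ * v 2 + a ^ 2 * ((a + 1) ^ 2)⁻¹ * v 3,
        (a + 1) ^ 2 * v 0 + a⁻¹ * v 1 + a * v 5,
        a⁻¹ * v 0 + (a + 1) ^ 2 * (a ^ 2)⁻¹ * v 1 + a⁻¹ * v 4,
        a ^ 2 * ((a + 1) ^ 2)⁻¹ * v 6 + ((a + 1) ^ 2)⁻¹ * v 7,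
        ((a + 1) ^ 2)⁻¹ * v 6 + a ^ 2 * ((a + 1) ^ 2)⁻¹ * v 7] := by
  ext i
  fin_cases i <;>
    simp [xMinusEven, Matrix.mulVec, dotProduct, Fin.sum_univ_succ] <;> ring

theorem rotate_rotate (v : Fin 8 → F) : rotate (rotate v) =
    ![v 0 + v 4, v 2, v 3, v 1, v 4 + (v 0 + v 4), v 6, v 7, v 5] := rfl

variable [CharP F 2] {a : F}

theorem traceMatrix_eq (ha : a ≠ 0) (ha' : a + 1 ≠ 0) (c : F) :
    xMinusEven F a * yMinusEven F + yMinusEven F * yMinusEven F * xMinusEven F a + c • 1 =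
      traceMatrix a (a + 1) c := by
  have h2 : (2 : F) = 0 := two_eq_zero_of_charTwo
  refine ext_of_mulVec_single fun j => ?_
  generalize (Pi.single j 1 : Fin 8 → F) = z
  rw [add_mulVec, add_mulVec, ← mulVec_mulVec, ← mulVec_mulVec, ← mulVec_mulVec, smul_mulVec,
    one_mulVec, yMinusEven_mulVec, yMinusEven_mulVec, yMinusEven_mulVec, rotate_rotate,
    xMinusEven_mulVec, xMinusEven_mulVec]
  ext i
  fin_cases i <;>
    simp [rotate, traceMatrix, Matrix.mulVec, dotProduct, Fin.sum_univ_succ] <;>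
    field_simp <;> grind

set_option maxHeartbeats 4000000 in
theorem traceMatrix_mul_traceMatrix {b : F} (ha : a ≠ 0) (hb : b ≠ 0) (hab : b = a + 1) :
    traceMatrix a b (b ^ 2)⁻¹ * traceMatrix a b (b ^ 2 + (b ^ 2)⁻¹) =
      traceProductMatrix a b := by
  have h2 : (2 : F) = 0 := two_eq_zero_of_charTwo
  rw [traceMatrix, traceMatrix, traceProductMatrix]
  ext i j
  fin_cases i <;> fin_cases j <;>
    simp only [Matrix.mul_apply, Fin.sum_univ_eight, of_apply, cons_val, cons_val_zero,
      Fin.zero_eta, Fin.mk_one, Fin.reduceFinMk, zero_mul, mul_zero, zero_add, add_zero] <;>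
    field_simp <;> grind

set_option maxHeartbeats 4000000 in
theorem traceMatrix_mul_traceProductMatrix {b : F} (ha : a ≠ 0) (hb : b ≠ 0) (hab : b = a + 1)
    (j : Fin 8) :
    (traceMatrix a b 1 * traceProductMatrix a b) *ᵥ (Pi.single j 1) =
      (a * (b ^ 4)⁻¹) • (polarForm (Pi.single j 1) (uVec₀ a) • uVec₁ a +
        polarForm (Pi.single j 1) (uVec₁ a) • uVec₀ a) := by
  have h2 : (2 : F) = 0 := two_eq_zero_of_charTwo
  rw [mulVec_single_one, traceMatrix, traceProductMatrix]
  ext i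
  fin_cases j <;> simp only [polarForm, uVec₀, uVec₁] <;> fin_cases i <;>
    simp only [Matrix.mul_apply, Fin.sum_univ_eight, of_apply, cons_val, cons_val_zero,
      Fin.zero_eta, Fin.mk_one, Fin.reduceFinMk, zero_mul, mul_zero, zero_add, add_zero, one_mul,
      mul_one,
      col_apply, Pi.add_apply, Pi.smul_apply, smul_eq_mul, Pi.single_apply, Fin.reduceEq,
      ↓reduceIte] <;>
    field_simp <;> grind

theorem traceMatrix_mulVec_uVec₀ (ha : a ≠ 0) (ha' : a + 1 ≠ 0) :
    traceMatrix a (a + 1) 1 *ᵥ uVec₀ a = 0 := by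
  have h2 : (2 : F) = 0 := two_eq_zero_of_charTwo
  ext i
  fin_cases i <;>
    simp [traceMatrix, uVec₀, Matrix.mulVec, dotProduct, Fin.sum_univ_succ] <;>
    field_simp <;> grind

theorem traceMatrix_mulVec_uVec₁ (ha : a ≠ 0) (ha' : a + 1 ≠ 0) :
    traceMatrix a (a + 1) 1 *ᵥ uVec₁ a = 0 := by
  have h2 : (2 : F) = 0 := two_eq_zero_of_charTwo
  ext i
  fin_cases i <;>
    simp [traceMatrix, uVec₁, Matrix.mulVec, dotProduct, Fin.sum_univ_succ] <;>
    field_simp <;> grind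

end Perturbed

section Generators

open Polynomial

variable {F : Type*} [Field F]

theorem aeval_palindromicSextic_of_inverse {A : Type*} [Ring A] [Algebra F A] {w w' N : A} {c d : F}
    (hw : w * w' = 1) (hw' : w' * w = 1)
    (hN : (w + w' + (1 : F) • (1 : A)) * ((w + w' + c • (1 : A)) * (w + w' + d • (1 : A))) = N)
    (h0 : (w + w' + (1 : F) • (1 : A)) * N = 0) :
    aeval w (palindromicSextic c d) = N ∧
      aeval w (palindromicQuadratic 1 * palindromicSextic c d) = 0 := by
  have hq : ∀ e : F, aeval w (palindromicQuadratic e) = w * (w + w' + e • (1 : A)) := fun e => by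
    simp [palindromicQuadratic, Algebra.smul_def, mul_add, hw, pow_two,
      Algebra.commutes e w]
    abel
  have hcomm : ∀ e : F, Commute w (w + w' + e • (1 : A)) := fun e =>
    ((Commute.refl w).add_right (by rw [Commute, SemiconjBy, hw, hw'])).add_right
      ((Commute.one_right w).smul_right e)
  have hwN : w * w * N + w * N + N = 0 := by
    have : w * ((w + w' + (1 : F) • (1 : A)) * N) = 0 := by rw [h0, mul_zero]
    rw [← mul_assoc, mul_add, mul_add, hw, one_smul, mul_one, add_mul, add_mul, one_mul] at this
    rw [← this]; abel
  have hw3 : w * w * w * N = N := by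
    have : w * (w * w * N + w * N + N) - (w * w * N + w * N + N) = w * w * w * N - N := by
      noncomm_ring
    rw [hwN, mul_zero, sub_zero] at this
    exact (sub_eq_zero.1 this.symm)
  have h1 : aeval w (palindromicSextic c d) = N := by
    rw [palindromicSextic, map_mul, map_mul, hq, hq, hq, ← hw3, ← hN]
    have e1 := (hcomm 1).eq
    have e2 := (hcomm c).eq
    generalize w + w' + (1 : F) • (1 : A) = s₁ at *
    generalize w + w' + c • (1 : A) = s₂ at *
    generalize w + w' + d • (1 : A) = s₃ at *
    calc w * s₁ * (w * s₂) * (w * s₃) = w * (s₁ * w) * (s₂ * w) * s₃ := by simp only [mul_assoc]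
      _ = w * (w * s₁) * (w * s₂) * s₃ := by rw [e1, e2]
      _ = w * w * (s₁ * w) * s₂ * s₃ := by simp only [mul_assoc]
      _ = w * w * w * (s₁ * (s₂ * s₃)) := by rw [← e1]; simp only [mul_assoc]
  exact ⟨h1, by rw [map_mul, h1, hq, mul_assoc, h0, mul_zero]⟩

theorem siegel_eq_self {a : F} {p w z : Fin 8 → F} (hp : polarForm z p = 0)
    (hw : polarForm z w = 0) : siegel a p w z = z := by
  simp [siegel_apply, hp, hw]

variable [CharP F 2] {a : F}

theorem commute_of_siegel {g h : GL (Fin 8) F} {p w : Fin 8 → F}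
    (hg : g ∈ orthogonalGroupOf F (QMinusEven a)) (hh : ∀ z, h.1 *ᵥ z = siegel a p w z)
    (hp : g.1 *ᵥ p = p) (hw : g.1 *ᵥ w = w) : Commute g h :=
  gl_ext fun z => by
    rw [gl_mul_mulVec, gl_mul_mulVec, hh, hh, mulVec_siegel hg, hp, hw]

theorem mul_self_eq_one_of_siegel {g : GL (Fin 8) F} {p w : Fin 8 → F} (hw : polarForm p w = 0)
    (hg : ∀ z, g.1 *ᵥ z = siegel a p w z) : g * g = 1 :=
  gl_ext fun z => by
    rw [gl_mul_mulVec, hg, hg, siegel_involutive hw, Units.val_one, one_mulVec]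

theorem xMinusEven_mul_self (ha : a ≠ 0) (ha' : a + 1 ≠ 0) :
    xMinusEven F a * xMinusEven F a = 1 := by
  have h2 : (2 : F) = 0 := two_eq_zero_of_charTwo
  refine ext_of_mulVec_single fun j => ?_
  generalize (Pi.single j 1 : Fin 8 → F) = z
  rw [← mulVec_mulVec, one_mulVec, xMinusEven_mulVec, xMinusEven_mulVec]
  ext i
  fin_cases i <;> simp <;> field_simp <;> grind

theorem yMinusEven_mul_self_mul_self : yMinusEven F * yMinusEven F * yMinusEven F = 1 := by
  have h2 : (2 : F) = 0 := two_eq_zero_of_charTwo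
  refine ext_of_mulVec_single fun j => ?_
  generalize (Pi.single j 1 : Fin 8 → F) = z
  rw [← mulVec_mulVec, ← mulVec_mulVec, one_mulVec, yMinusEven_mulVec, yMinusEven_mulVec,
    yMinusEven_mulVec, rotate_rotate]
  ext i
  fin_cases i <;> simp [rotate] <;> grind

theorem QMinusEven_uVec₀ (ha : a ≠ 0) : QMinusEven a (uVec₀ a) = 0 := by
  have h2 : (2 : F) = 0 := two_eq_zero_of_charTwo
  simp [QMinusEven, uVec₀]
  field_simp
  grind

theorem QMinusEven_uVec₁ (ha : a ≠ 0) : QMinusEven a (uVec₁ a) = 0 := by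
  have h2 : (2 : F) = 0 := two_eq_zero_of_charTwo
  simp [QMinusEven, uVec₁]
  field_simp
  grind

theorem polarForm_uVec₀_uVec₁ (ha : a ≠ 0) : polarForm (uVec₀ a) (uVec₁ a) = 0 := by
  have h2 : (2 : F) = 0 := two_eq_zero_of_charTwo
  simp [polarForm, uVec₀, uVec₁]
  field_simp
  grind

theorem xMinusEven_mulVec_eq_siegel (ha : a ≠ 0) (ha' : a + 1 ≠ 0) (z : Fin 8 → F) :
    xMinusEven F a *ᵥ z = siegel a (sVec₀ a) (nVec a) (siegel a (dVec₀ 1) (wVec a) z) := by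
  have h2 : (2 : F) = 0 := two_eq_zero_of_charTwo
  rw [xMinusEven_mulVec]
  ext i
  simp only [siegel_apply, polarForm, QMinusEven, Pi.add_apply, Pi.smul_apply, smul_eq_mul,
    sVec₀, nVec, dVec₀, wVec]
  fin_cases i <;> simp <;> field_simp <;> grind

end Generators

section Generation

open Polynomial

variable {F : Type*} [Field F] [CharP F 2] {a : F} {H : Subgroup (GL (Fin 8) F)}
  {x y : GL (Fin 8) F}

theorem aeval_palindromicSextic_generators (ha : a ≠ 0) (ha' : a + 1 ≠ 0)
    (hx : x.1 = xMinusEven F a) (hy : y.1 = yMinusEven F) :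
    (∀ z, aeval (x * y).1 (palindromicSextic ((a + 1) ^ 2)⁻¹ ((a + 1) ^ 2 + ((a + 1) ^ 2)⁻¹)) *ᵥ z =
      (a * ((a + 1) ^ 4)⁻¹) • (polarForm z (uVec₀ a) • uVec₁ a +
        polarForm z (uVec₁ a) • uVec₀ a)) ∧
    aeval (x * y).1 (palindromicQuadratic 1 *
      palindromicSextic ((a + 1) ^ 2)⁻¹ ((a + 1) ^ 2 + ((a + 1) ^ 2)⁻¹)) = 0 := by
  have hxx := xMinusEven_mul_self ha ha'
  have hyy := yMinusEven_mul_self_mul_self (F := F)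
  have hw : (x * y).1 * (yMinusEven F * yMinusEven F * xMinusEven F a) = 1 := by
    rw [Units.val_mul, hx, hy, mul_assoc, ← mul_assoc (yMinusEven F), ← mul_assoc (yMinusEven F),
      hyy, one_mul, hxx]
  have hw' : (yMinusEven F * yMinusEven F * xMinusEven F a) * (x * y).1 = 1 := by
    rw [Units.val_mul, hx, hy, mul_assoc, ← mul_assoc (xMinusEven F a), hxx, one_mul, hyy]
  have hs : ∀ c : F, (x * y).1 + yMinusEven F * yMinusEven F * xMinusEven F a + c • 1 =
      traceMatrix a (a + 1) c := fun c => by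
    rw [Units.val_mul, hx, hy, traceMatrix_eq ha ha']
  have hNz : ∀ z, (traceMatrix a (a + 1) 1 * traceProductMatrix a (a + 1)) *ᵥ z =
      (a * ((a + 1) ^ 4)⁻¹) • (polarForm z (uVec₀ a) • uVec₁ a +
        polarForm z (uVec₁ a) • uVec₀ a) := by
    let L : (Fin 8 → F) →ₗ[F] (Fin 8 → F) := (a * ((a + 1) ^ 4)⁻¹) •
      ((polarLin (uVec₀ a)).smulRight (uVec₁ a) + (polarLin (uVec₁ a)).smulRight (uVec₀ a))
    have hL : mulVecLin (traceMatrix a (a + 1) 1 * traceProductMatrix a (a + 1)) = L := by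
      refine LinearMap.pi_ext' fun j => LinearMap.ext_ring ?_
      have hj := traceMatrix_mul_traceProductMatrix ha ha' rfl j
      rw [← mulVec_mulVec] at hj
      simpa [L, polarForm_comm] using hj
    intro z
    simpa [L, polarForm_comm] using LinearMap.congr_fun hL z
  obtain ⟨h1, h2⟩ := aeval_palindromicSextic_of_inverse
    (c := ((a + 1) ^ 2)⁻¹) (d := (a + 1) ^ 2 + ((a + 1) ^ 2)⁻¹) hw hw'
    (N := traceMatrix a (a + 1) 1 * traceProductMatrix a (a + 1))
    (by rw [hs, hs, hs, traceMatrix_mul_traceMatrix ha ha' rfl]) (by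
      rw [hs]
      refine ext_of_mulVec_single fun j => ?_
      rw [← mulVec_mulVec, hNz, zero_mulVec, mulVec_smul, mulVec_add, mulVec_smul, mulVec_smul,
        traceMatrix_mulVec_uVec₀ ha ha', traceMatrix_mulVec_uVec₁ ha ha']
      simp)
  exact ⟨fun z => by rw [h1, hNz], h2⟩

theorem exists_hasSiegel_uVec₀ [Finite F] (ha : a ≠ 0) (ha' : a + 1 ≠ 0)
    (hx : x.1 = xMinusEven F a) (hy : y.1 = yMinusEven F) (hxH : x ∈ H) (hyH : y ∈ H) :
    ∃ δ : F, δ ≠ 0 ∧ HasSiegel a H (uVec₀ a) (δ • uVec₁ a) := by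
  have two : (2 : F) = 0 := two_eq_zero_of_charTwo
  obtain ⟨h1, h2⟩ := aeval_palindromicSextic_generators ha ha' hx hy
  have hwH : x * y ∈ H := H.mul_mem hxH hyH
  have horth : ∀ δ : F, polarForm (uVec₀ a) (δ • uVec₁ a) = 0 := fun δ => by
    rw [polarForm_smul_right, polarForm_uVec₀_uVec₁ ha, mul_zero]
  have hval : ∀ (κ : F) (u : GL (Fin 8) F),
      (∀ z, u.1 *ᵥ z = siegel a (uVec₀ a) ((κ * (a * ((a + 1) ^ 4)⁻¹)) • uVec₁ a) z) →
      u.1 = 1 + κ • aeval (x * y).1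
        (palindromicSextic ((a + 1) ^ 2)⁻¹ ((a + 1) ^ 2 + ((a + 1) ^ 2)⁻¹)) := fun κ u hu => by
    refine ext_of_mulVec_single fun j => ?_
    rw [hu, siegel_eq_of_singular (by rw [QMinusEven_smul, QMinusEven_uVec₁ ha, mul_zero]),
      add_mulVec, smul_mulVec, h1, one_mulVec, polarForm_smul_right]
    module
  have hγ : a * ((a + 1) ^ 4)⁻¹ ≠ 0 := mul_ne_zero ha (inv_ne_zero (pow_ne_zero 4 ha'))
  by_cases hcase : a ^ 2 + a + 1 = 0
  · have hc : ((a + 1) ^ 2)⁻¹ = a + 1 := inv_eq_of_mul_eq_one_right (by grind)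
    have hd : (a + 1) ^ 2 + (a + 1) = 1 := by grind
    rw [hc, hd] at h2 hval
    have hb' : 1 + (a + 1) ≠ 0 := by rwa [show 1 + (a + 1) = a by linear_combination two]
    refine ⟨(1 + (a + 1))⁻¹ * (a * ((a + 1) ^ 4)⁻¹), mul_ne_zero (inv_ne_zero hb') hγ,
      QMinusEven_uVec₀ ha, horth _, ?_⟩
    obtain ⟨u, -, hu⟩ := exists_orthogonal_siegel (QMinusEven_uVec₀ ha)
      (horth ((1 + (a + 1))⁻¹ * (a * ((a + 1) ^ 4)⁻¹)))
    refine ⟨u, ?_, hu⟩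
    have hpow : (x * y) ^ 30 = u := by
      ext1
      rw [hval _ u hu, Units.val_pow_eq_pow_val]
      exact pow_thirty_eq_of_aeval (by grind) hb' h2
    exact hpow ▸ H.pow_mem hwH 30
  · have hc : 1 + ((a + 1) ^ 2)⁻¹ = a ^ 2 / (a + 1) ^ 2 := by field_simp; grind
    have hd : 1 + ((a + 1) ^ 2 + ((a + 1) ^ 2)⁻¹) = (a ^ 2 + a + 1) ^ 2 / (a + 1) ^ 2 := by
      field_simp; grind
    have hc0 : 1 + ((a + 1) ^ 2)⁻¹ ≠ 0 := by
      rw [hc]; exact div_ne_zero (pow_ne_zero 2 ha) (pow_ne_zero 2 ha')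
    have hd0 : 1 + ((a + 1) ^ 2 + ((a + 1) ^ 2)⁻¹) ≠ 0 := by
      rw [hd]; exact div_ne_zero (pow_ne_zero 2 hcase) (pow_ne_zero 2 ha')
    have hdd : (a + 1) ^ 2 + ((a + 1) ^ 2)⁻¹ = a ^ 4 / (a + 1) ^ 2 := by field_simp; grind
    have hκ := mul_ne_zero hc0 hd0
    refine ⟨_ * (a * ((a + 1) ^ 4)⁻¹), mul_ne_zero (inv_ne_zero hκ) hγ,
      QMinusEven_uVec₀ ha, horth _, ?_⟩
    obtain ⟨u, -, hu⟩ := exists_orthogonal_siegel (QMinusEven_uVec₀ ha) (horth _)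
    refine ⟨u, ?_, hu⟩
    refine mem_of_mem_of_perturb (inv_ne_zero (pow_ne_zero 2 ha')) ?_ ?_ ?_ ?_ hκ h2
      (hval _ u hu) (mul_self_eq_one_of_siegel (horth _) hu) hwH
    · rw [hdd]; exact div_ne_zero (pow_ne_zero 4 ha) (pow_ne_zero 2 ha')
    · intro h; exact hc0 (by rw [← h]; linear_combination two)
    · intro h; exact hd0 (by rw [← h]; linear_combination two)
    · intro h; exact pow_ne_zero 2 ha' (by linear_combination -h)

theorem QMinusEven_wVec (ha : a ≠ 0) (ha' : a + 1 ≠ 0) : QMinusEven a (wVec a) = 0 := by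
  have h2 : (2 : F) = 0 := two_eq_zero_of_charTwo
  simp [QMinusEven, wVec]
  field_simp
  grind

theorem QMinusEven_rotate (a : F) (v : Fin 8 → F) : QMinusEven a (rotate v) = QMinusEven a v := by
  have h2 : (2 : F) = 0 := two_eq_zero_of_charTwo
  simp [QMinusEven, rotate]
  grind

theorem polarForm_rotate (u v : Fin 8 → F) :
    polarForm (rotate u) (rotate v) = polarForm u v := by
  have h2 : (2 : F) = 0 := two_eq_zero_of_charTwo
  simp [polarForm, rotate]
  grind

theorem polarForm_dVec₀_wVec (a : F) : polarForm (dVec₀ 1) (wVec a) = 0 := by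
  have h2 : (2 : F) = 0 := two_eq_zero_of_charTwo
  simp [polarForm, dVec₀, wVec]
  grind

theorem polarForm_sVec₀_nVec (ha : a ≠ 0) : polarForm (sVec₀ a) (nVec a) = 0 := by
  have h2 : (2 : F) = 0 := two_eq_zero_of_charTwo
  simp [polarForm, sVec₀, nVec]
  field_simp
  grind

theorem polarForm_rotate_wVec_uVec (ha : a ≠ 0) (ha' : a + 1 ≠ 0) :
    polarForm (dVec₁ 1) (uVec₀ a) * polarForm (rotate (wVec a)) (uVec₁ a) +
      polarForm (dVec₁ 1) (uVec₁ a) * polarForm (rotate (wVec a)) (uVec₀ a) =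
        (a + 1) ^ 2 / a := by
  have h2 : (2 : F) = 0 := two_eq_zero_of_charTwo
  simp [polarForm, rotate, wVec, dVec₁, uVec₀, uVec₁]
  field_simp
  grind

theorem polarForm_uVec₀_sVec₁ (a : F) : polarForm (uVec₀ a) (sVec₁ a) = 0 := by
  have h2 : (2 : F) = 0 := two_eq_zero_of_charTwo
  simp [polarForm, sVec₁, uVec₀]
  field_simp
  grind

theorem polarForm_uVec₁_sVec₁ (a : F) : polarForm (uVec₁ a) (sVec₁ a) = 0 := by
  have h2 : (2 : F) = 0 := two_eq_zero_of_charTwo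
  simp [polarForm, sVec₁, uVec₁]
  field_simp
  grind

theorem polarForm_uVec₀_rotate_nVec (ha : a ≠ 0) : polarForm (uVec₀ a) (rotate (nVec a)) = 0 := by
  have h2 : (2 : F) = 0 := two_eq_zero_of_charTwo
  simp [polarForm, rotate, nVec, uVec₀]
  field_simp
  grind

theorem polarForm_uVec₁_rotate_nVec (ha : a ≠ 0) : polarForm (uVec₁ a) (rotate (nVec a)) = 0 := by
  have h2 : (2 : F) = 0 := two_eq_zero_of_charTwo
  simp [polarForm, rotate, nVec, uVec₁]
  field_simp
  grind

end Generation

section Factors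

variable {F : Type*} [Field F] [CharP F 2] {a : F} {H : Subgroup (GL (Fin 8) F)}
  {x y : GL (Fin 8) F}

theorem yMinusEven_mem_orthogonalGroupOf (hy : y.1 = yMinusEven F) :
    y ∈ orthogonalGroupOf F (QMinusEven a) := fun v => by
  rw [hy, yMinusEven_mulVec, QMinusEven_rotate]

theorem hasSiegel_sVec₀_nVec_and_dVec₀_wVec [Finite F] (ha : a ≠ 0) (ha' : a + 1 ≠ 0)
    (hx : x.1 = xMinusEven F a) (hy : y.1 = yMinusEven F) (hxH : x ∈ H) (hyH : y ∈ H) :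
    HasSiegel a H (sVec₀ a) (nVec a) ∧ HasSiegel a H (dVec₀ 1) (wVec a) := by
  have hyO : y ∈ orthogonalGroupOf F (QMinusEven a) := yMinusEven_mem_orthogonalGroupOf hy
  have hyz : ∀ z, y.1 *ᵥ z = rotate z := fun z => by rw [hy, yMinusEven_mulVec]
  obtain ⟨δ, hδ, -, -, u, huH, hu⟩ := exists_hasSiegel_uVec₀ ha ha' hx hy hxH hyH
  obtain ⟨v, hvO, hv⟩ := exists_orthogonal_siegel (QMinusEven_sVec₀ a) (polarForm_sVec₀_nVec ha)
  obtain ⟨t, -, ht⟩ := exists_orthogonal_siegel (QMinusEven_dVec₀ a 1) (polarForm_dVec₀_wVec a)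
  have hvt : x = v * t := gl_ext fun z => by
    rw [gl_mul_mulVec, hv, ht, hx, xMinusEven_mulVec_eq_siegel ha ha']
  have hv' : ∀ z, (y * v * y⁻¹).1 *ᵥ z = siegel a (sVec₁ a) (rotate (nVec a)) z := fun z => by
    rw [gl_mul_mulVec, gl_mul_mulVec, hv, mulVec_siegel hyO, gl_mulVec_inv_mulVec, hyz, hyz,
      rotate_sVec₀]
  have ht' : ∀ z, (y * t * y⁻¹).1 *ᵥ z = siegel a (dVec₁ 1) (rotate (wVec a)) z := fun z => by
    rw [gl_mul_mulVec, gl_mul_mulVec, ht, mulVec_siegel hyO, gl_mulVec_inv_mulVec, hyz, hyz,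
      rotate_dVec₀]
  have hvO' : y * v * y⁻¹ ∈ orthogonalGroupOf F (QMinusEven a) :=
    Subgroup.mul_mem _ (Subgroup.mul_mem _ hyO hvO) (Subgroup.inv_mem _ hyO)
  have hvt' : Commute v t := by
    refine commute_of_siegel hvO ht ?_ ?_
    · rw [hv, siegel_nVec_dVec₀]
    · rw [hv, siegel_eq_self (by simp [polarForm, wVec, sVec₀]) ?_]
      have h2 : (2 : F) = 0 := two_eq_zero_of_charTwo
      simp [polarForm, wVec, nVec]
      field_simp
      grind
  have hv'u : Commute (y * v * y⁻¹) u := by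
    refine commute_of_siegel hvO' hu ?_ ?_
    · rw [hv', siegel_eq_self (polarForm_uVec₀_sVec₁ a) (polarForm_uVec₀_rotate_nVec ha)]
    · rw [mulVec_smul, hv', siegel_eq_self (polarForm_uVec₁_sVec₁ a)
        (polarForm_uVec₁_rotate_nVec ha)]
  have hodd : Odd (orderOf ((y * t * y⁻¹) * u)) := by
    refine odd_orderOf_mul_of_siegel (by rw [QMinusEven_rotate, QMinusEven_wVec ha ha'])
      (by rw [QMinusEven_smul, QMinusEven_uVec₁ ha, mul_zero])
      (by rw [← rotate_dVec₀, polarForm_rotate, polarForm_dVec₀_wVec])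
      (by rw [polarForm_smul_right, polarForm_uVec₀_uVec₁ ha, mul_zero]) ht' hu ?_
    have := mul_ne_zero hδ (div_ne_zero (pow_ne_zero 2 ha') ha)
    rw [← polarForm_rotate_wVec_uVec ha ha'] at this
    convert this using 1
    simp only [polarForm_smul_right]
    ring
  have hvH : y * v * y⁻¹ ∈ H := by
    refine mem_of_mul_mem_of_odd_orderOf (r := (y * t * y⁻¹) * u) ?_ ?_ hodd ?_
    · exact mul_self_eq_one_of_siegel
        (by rw [← rotate_sVec₀, polarForm_rotate, polarForm_sVec₀_nVec ha]) hv'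
    · refine Commute.mul_right ?_ hv'u
      exact (Commute.conj_iff y).2 hvt'
    · rw [← mul_assoc, show y * v * y⁻¹ * (y * t * y⁻¹) = y * x * y⁻¹ by rw [hvt]; group]
      exact H.mul_mem (H.mul_mem (H.mul_mem hyH hxH) (H.inv_mem hyH)) huH
  have hvH' : v ∈ H := by
    have := H.mul_mem (H.mul_mem (H.inv_mem hyH) hvH) hyH
    rwa [show y⁻¹ * (y * v * y⁻¹) * y = v by group] at this
  have htH : t ∈ H := by
    have := H.mul_mem (H.inv_mem hvH') hxH
    rwa [hvt, inv_mul_cancel_left] at this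
  exact ⟨⟨QMinusEven_sVec₀ a, polarForm_sVec₀_nVec ha, v, hvH', hv⟩,
    QMinusEven_dVec₀ a 1, polarForm_dVec₀_wVec a, t, htH, ht⟩

theorem hasSiegel_sVec₀_dVec₁ [Finite F] (ha : a ≠ 0) (ha' : a + 1 ≠ 0)
    (hH : H ≤ orthogonalGroupOf F (QMinusEven a)) (hv : HasSiegel a H (sVec₀ a) (nVec a))
    (ht : HasSiegel a H (dVec₁ 1) (rotate (wVec a))) :
    HasSiegel a H (sVec₀ a) (dVec₁ ((a + 1) ^ 2 * (a ^ 2)⁻¹)) := by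
  have h2 : (2 : F) = 0 := two_eq_zero_of_charTwo
  set l := (a + 1) ^ 2 * (a ^ 2)⁻¹ with hl
  obtain ⟨hs, hsn, v, hvH, hv⟩ := hv
  obtain ⟨-, hdw, t, htH, ht⟩ := ht
  have hsd : polarForm (sVec₀ a) (dVec₁ l) = 0 := by simp [polarForm, sVec₀, dVec₁]
  obtain ⟨c, hcO, hc⟩ := exists_orthogonal_siegel hs hsd
  refine ⟨hs, hsd, c, ?_, hc⟩
  have hcc : c * c = 1 := mul_self_eq_one_of_siegel hsd hc
  have hcv : Commute c v := gl_ext fun z => by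
    rw [gl_mul_mulVec, gl_mul_mulVec, hc, hv, hc, hv, siegel_siegel hsd hsn,
      siegel_siegel hsn hsd, add_comm]
  have hvc : ∀ z, (v * c).1 *ᵥ z = siegel a (sVec₀ a) (nVec a + dVec₁ l) z := fun z => by
    rw [gl_mul_mulVec, hv, hc, siegel_siegel hsn hsd]
  have hct : Commute c t := by
    have htd : t.1 *ᵥ dVec₁ l = dVec₁ l := by
      have hd : dVec₁ l = l • dVec₁ (1 : F) := (smul_dVec₁ l).symm
      rw [ht, siegel_eq_self (by rw [hd, polarForm_smul_left, polarForm_self, mul_zero])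
        (by rw [hd, polarForm_smul_left, hdw, mul_zero])]
    have hts : t.1 *ᵥ sVec₀ a =
        sVec₀ a + polarForm (sVec₀ a) (rotate (wVec a)) • dVec₁ (1 : F) := by
      rw [ht, siegel_apply, show polarForm (sVec₀ a) (dVec₁ 1) = 0 by
        simp [polarForm, sVec₀, dVec₁]]
      simp
    refine gl_ext fun z => ?_
    rw [gl_mul_mulVec, gl_mul_mulVec, hc, hc, mulVec_siegel (hH htH), htd, hts,
      siegel_eq_of_singular (QMinusEven_dVec₁ a l), siegel_eq_of_singular (QMinusEven_dVec₁ a l),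
      polarForm_add_right, polarForm_smul_right, ← smul_dVec₁ l, polarForm_smul_right]
    ext i
    simp only [Pi.add_apply, Pi.smul_apply, smul_eq_mul]
    linear_combination -(polarForm (sVec₀ a) (rotate (wVec a)) *
      polarForm (t.1 *ᵥ z) (dVec₁ 1) * l * dVec₁ (1 : F) i) * h2
  refine mem_of_mul_mem_of_odd_orderOf (r := v * c * t) hcc ((hcv.mul_right rfl).mul_right hct)
    ?_ ?_
  · refine odd_orderOf_mul_of_siegel (a := a) ?_ ?_ ?_ hdw hvc ht ?_
    · simp [QMinusEven, nVec, dVec₁, hl]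
      field_simp
      grind
    · rw [QMinusEven_rotate, QMinusEven_wVec ha ha']
    · rw [polarForm_add_right, hsn, hsd, add_zero]
    · have : polarForm (sVec₀ a) (dVec₁ 1) * polarForm (nVec a + dVec₁ l) (rotate (wVec a)) +
          polarForm (sVec₀ a) (rotate (wVec a)) * polarForm (nVec a + dVec₁ l) (dVec₁ 1) =
          a ^ 2 / (a + 1) ^ 2 := by
        simp [polarForm, sVec₀, nVec, dVec₁, rotate, wVec, hl]
        field_simp
        grind
      rw [this]
      exact div_ne_zero (pow_ne_zero 2 ha) (pow_ne_zero 2 ha')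
  · rw [← mul_assoc, ← mul_assoc, hcv.eq, mul_assoc v, hcc, mul_one]
    exact H.mul_mem hvH htH

end Factors

section Generation

variable {F : Type*} [Field F] [CharP F 2] {a : F} {x y : GL (Fin 8) F}

theorem xMinusEven_mem_siegelSubgroup (ha : a ≠ 0) (ha' : a + 1 ≠ 0)
    (hx : x.1 = xMinusEven F a) : x ∈ siegelSubgroup a := by
  obtain ⟨v, -, hv⟩ := exists_orthogonal_siegel (QMinusEven_sVec₀ a) (polarForm_sVec₀_nVec ha)
  obtain ⟨t, -, ht⟩ := exists_orthogonal_siegel (QMinusEven_dVec₀ a 1) (polarForm_dVec₀_wVec a)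
  have hvt : x = v * t := gl_ext fun z => by
    rw [gl_mul_mulVec, hv, ht, hx, xMinusEven_mulVec_eq_siegel ha ha']
  rw [hvt]
  exact mul_mem (siegel_mem_siegelSubgroup (QMinusEven_sVec₀ a) (polarForm_sVec₀_nVec ha) hv)
    (siegel_mem_siegelSubgroup (QMinusEven_dVec₀ a 1) (polarForm_dVec₀_wVec a) ht)

theorem xMinusEven_mem_orthogonalGroupOf (ha : a ≠ 0) (ha' : a + 1 ≠ 0)
    (hx : x.1 = xMinusEven F a) : x ∈ orthogonalGroupOf F (QMinusEven a) := fun z => by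
  rw [hx, xMinusEven_mulVec_eq_siegel ha ha',
    QMinusEven_siegel (QMinusEven_sVec₀ a) (polarForm_sVec₀_nVec ha),
    QMinusEven_siegel (QMinusEven_dVec₀ a 1) (polarForm_dVec₀_wVec a)]

theorem yMinusEven_mem_siegelSubgroup [Finite F] (hy : y.1 = yMinusEven F) :
    y ∈ siegelSubgroup a := by
  have hyy := mul_self_mem_siegelSubgroup (yMinusEven_mem_orthogonalGroupOf (a := a) hy)
  have hy3 : y * y * y = 1 := Units.ext <| by
    simpa [hy] using yMinusEven_mul_self_mul_self (F := F)
  have hy4 : (y * y) * (y * y) = y := by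
    rw [← mul_assoc, hy3, one_mul]
  exact hy4 ▸ mul_mem hyy hyy

theorem siegelSubgroup_le_closure_pair [Finite F] (ha : a ≠ 0) (ha' : a + 1 ≠ 0)
    (hgen : Subfield.closure {a} = ⊤) (hx : x.1 = xMinusEven F a) (hy : y.1 = yMinusEven F) :
    siegelSubgroup a ≤ Subgroup.closure {x, y} := by
  set H := Subgroup.closure {x, y} with hHdef
  have hxH : x ∈ H := Subgroup.subset_closure (by simp)
  have hyH : y ∈ H := Subgroup.subset_closure (by simp)
  have hH : H ≤ orthogonalGroupOf F (QMinusEven a) := by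
    rw [hHdef, Subgroup.closure_le]
    rintro g (rfl | rfl)
    · exact xMinusEven_mem_orthogonalGroupOf ha ha' hx
    · exact yMinusEven_mem_orthogonalGroupOf hy
  have hyz : ∀ z, y.1 *ᵥ z = rotate z := fun z => by rw [hy, yMinusEven_mulVec]
  have hrot : ∀ {p w : Fin 8 → F}, HasSiegel a H p w → HasSiegel a H (rotate p) (rotate w) :=
    fun h => by simpa only [hyz] using h.conj hH hyH
  obtain ⟨hv, ht⟩ := hasSiegel_sVec₀_nVec_and_dVec₀_wVec ha ha' hx hy hxH hyH
  have hT := hasSiegel_sVec₀_dVec₁ ha ha' hH hv (by simpa only [rotate_dVec₀] using hrot ht)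
  have ho : ∀ w, polarForm (dVec₀ 1) w = 0 → HasSiegel a H (dVec₀ 1) w := fun w hw =>
    hasSiegel_dVec₀ ha ha' hgen hH hrot ht hv hT hw
  obtain ⟨k, hkH, hk⟩ : ∃ k ∈ H, polarForm (dVec₀ 1) (k.1 *ᵥ dVec₀ 1) ≠ 0 := by
    refine ⟨y * (x * (y * (x * y))), mul_mem hyH (mul_mem hxH (mul_mem hyH (mul_mem hxH hyH))), ?_⟩
    rw [gl_mul_mulVec, gl_mul_mulVec, gl_mul_mulVec, gl_mul_mulVec, hyz, hyz, hyz, hx,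
      xMinusEven_mulVec, xMinusEven_mulVec]
    simp [polarForm, dVec₀, rotate, ha]
  refine siegelSubgroup_le fun p w hp hpw => hasSiegel_of_opposite hH (QMinusEven_dVec₀ a 1)
    (by rw [hH hkH, QMinusEven_dVec₀]) hk ho (fun w hw => ?_) hp hpw
  rw [← gl_mulVec_inv_mulVec k w, polarForm_mulVec (hH hkH)] at hw
  simpa only [gl_mulVec_inv_mulVec] using (ho _ hw).conj hH hkH

theorem closure_pair_eq_commutator [Finite F] (ha : a ≠ 0) (ha' : a + 1 ≠ 0)
    (hgen : Subfield.closure {a} = ⊤) (hx : x.1 = xMinusEven F a) (hy : y.1 = yMinusEven F) :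
    Subgroup.closure {x, y} =
      ⁅orthogonalGroupOf F (QMinusEven a), orthogonalGroupOf F (QMinusEven a)⁆ := by
  refine le_antisymm (le_trans ?_ (siegelSubgroup_le_commutator ha ha'))
    ((commutator_orthogonalGroupOf_le a).trans
      (siegelSubgroup_le_closure_pair ha ha' hgen hx hy))
  rw [Subgroup.closure_le]
  rintro g (rfl | rfl)
  · exact xMinusEven_mem_siegelSubgroup ha ha' hx
  · exact yMinusEven_mem_siegelSubgroup hy

end Generation

theorem ne_zero_and_add_one_ne_zero_of_closure_eq_top {F : Type*} [Field F] [Fintype F] [CharP F 2]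
    (hq : 4 ≤ Fintype.card F) {a : F} (ha : Subfield.closure {a} = ⊤) : a ≠ 0 ∧ a + 1 ≠ 0 := by
  by_contra h
  have hbot : Subfield.closure {a} ≤ (⊥ : Subfield F) := by
    rw [Subfield.closure_le, Set.singleton_subset_iff, SetLike.mem_coe]
    by_cases h0 : a = 0
    · exact h0 ▸ zero_mem _
    · have h1 : a = 1 := CharTwo.add_eq_zero.1 (by tauto)
      exact h1 ▸ one_mem _
  rw [ha] at hbot
  have hsurj : Function.Surjective (ZMod.castHom (dvd_refl 2) F) := by
    have := hbot.trans (bot_le (a := (ZMod.castHom (dvd_refl 2) F).fieldRange))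
    exact fun z => this (Subfield.mem_top z)
  have := Fintype.card_le_of_surjective _ hsurj
  rw [ZMod.card] at this
  omega

/-- For `q = 2^f ≥ 4` and `a` a generator of `𝔽_q` with `X² + X + (a+1)⁴`
irreducible over `𝔽_q`, the matrices `x(a)` and `y` have orders 2 and 3 and
generate `Ω₈⁻(q)`, the derived subgroup of the orthogonal group of the
minus-type quadratic form `Q`. In particular `Ω₈⁻(q)` is `(2,3)`-generated for
all even `q`. -/
theorem xMinusEven_yMinusEven_generate_omega8minus
    (f : ℕ) (F : Type*) [Field F] [Fintype F]
    (hcard : Fintype.card F = 2 ^ f) (hq : 4 ≤ Fintype.card F)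
    (a : F) (ha : Subfield.closure {a} = ⊤)
    (hirr : Irreducible (Polynomial.X ^ 2 + Polynomial.X +
      Polynomial.C ((a + 1) ^ 4) : Polynomial F)) :
    ∃ xu yu : GL (Fin 8) F,
      (xu : Matrix (Fin 8) (Fin 8) F) = xMinusEven F a ∧
      (yu : Matrix (Fin 8) (Fin 8) F) = yMinusEven F ∧
      orderOf xu = 2 ∧ orderOf yu = 3 ∧
      Subgroup.closure {xu, yu} =
        Subgroup.map (orthogonalGroupOf F (QMinusEven a)).subtype
          (commutator ↥(orthogonalGroupOf F (QMinusEven a))) := by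
  have hf : f ≠ 0 := by
    rintro rfl
    omega
  have : CharP F 2 := by
    have hF : ((2 ^ f : ℕ) : F) = 0 := hcard ▸ Nat.cast_card_eq_zero F
    rw [Nat.cast_pow] at hF
    exact CharTwo.of_one_ne_zero_of_two_eq_zero one_ne_zero
      (by simpa using (pow_eq_zero_iff hf).1 hF)
  obtain ⟨ha0, ha1⟩ := ne_zero_and_add_one_ne_zero_of_closure_eq_top hq ha
  have hxx := xMinusEven_mul_self ha0 ha1
  have hyyy := yMinusEven_mul_self_mul_self (F := F)
  let xu : GL (Fin 8) F := ⟨xMinusEven F a, xMinusEven F a, hxx, hxx⟩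
  let yu : GL (Fin 8) F :=
    ⟨yMinusEven F, yMinusEven F * yMinusEven F, by rw [← mul_assoc, hyyy], hyyy⟩
  refine ⟨xu, yu, rfl, rfl, ?_, ?_, ?_⟩
  · refine orderOf_eq_prime (Units.ext ?_) fun h => ?_
    · rw [pow_two]
      exact hxx
    · have := congrArg (fun g : GL (Fin 8) F => g.1 0 0) h
      simp [xu, xMinusEven] at this
  · refine orderOf_eq_prime (Units.ext ?_) fun h => ?_
    · rw [pow_succ, pow_two]
      exact hyyy
    · have := congrArg (fun g : GL (Fin 8) F => g.1 0 0) h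
      simp [yu, yMinusEven] at this
  · rw [Subgroup.map_subtype_commutator]
    exact closure_pair_eq_commutator ha0 ha1 ha rfl rfl
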